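/- Let X₀, X₁ be n-dimensional Banach lattices, E a finite-dimensional normed space of cotype 2, and 0 < θ < 1. Then d_θ[X₀(E), X₁(E)] ≤ √2 · C₂(E) · M_(2)(X₀)^{1-θ} · M_(2)(X₁)^{θ}, where d_θ[M₀,M₁] is the norm of the identity L(ℓ₂,[M₀,M₁]_θ) → [L(ℓ₂,M₀),L(ℓ₂,M₁)]_θ. -/

import Mathlib

open Complex MeasureTheory Finset

noncomputable section

namespace Paper

/-- The closed unit strip in the complex plane. -/
def Strip : Set ℂ := {z : ℂ | 0 ≤ z.re ∧ z.re ≤ 1}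

/-- The open unit strip in the complex plane. -/
def OStrip : Set ℂ := {z : ℂ | 0 < z.re ∧ z.re < 1}

/-- `N` is a norm on the complex vector space `V`. -/
def IsNormC {V : Type*} [AddCommGroup V] [Module ℂ V] (N : V → ℝ) : Prop :=
  (∀ x, 0 ≤ N x) ∧ (∀ x, N x = 0 → x = 0) ∧
  (∀ (c : ℂ) (x), N (c • x) = ‖c‖ * N x) ∧ (∀ x y, N (x + y) ≤ N x + N y)

/-- `N` is a lattice norm on `ℝⁿ`. -/
def IsLatticeNorm {n : ℕ} (N : (Fin n → ℝ) → ℝ) : Prop :=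
  (∀ x, 0 ≤ N x) ∧ (∀ x, N x = 0 → x = 0) ∧
  (∀ (c : ℝ) (x), N (c • x) = |c| * N x) ∧ (∀ x y, N (x + y) ≤ N x + N y) ∧
  (∀ x y, (∀ i, |x i| ≤ |y i|) → N x ≤ N y)

/-- The `r`-th power `X^r` of a lattice norm: `‖x‖_{X^r} = ‖ |x|^{1/r} ‖_X^r`. -/
def powNorm {n : ℕ} (r : ℝ) (N : (Fin n → ℝ) → ℝ) (x : Fin n → ℝ) : ℝ :=
  (N fun i => |x i| ^ (1 / r)) ^ r

/-- `N` is `p`-convex with constant `C`. -/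
def ConvexWith {n : ℕ} (p C : ℝ) (N : (Fin n → ℝ) → ℝ) : Prop :=
  ∀ (m : ℕ) (x : Fin m → Fin n → ℝ),
    N (fun j => (∑ i, |x i j| ^ p) ^ (1 / p)) ≤ C * (∑ i, N (x i) ^ p) ^ (1 / p)

/-- `N` is `p`-concave with constant `C`. -/
def ConcaveWith {n : ℕ} (p C : ℝ) (N : (Fin n → ℝ) → ℝ) : Prop :=
  ∀ (m : ℕ) (x : Fin m → Fin n → ℝ),
    (∑ i, N (x i) ^ p) ^ (1 / p) ≤ C * N (fun j => (∑ i, |x i j| ^ p) ^ (1 / p))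

/-- The dual lattice norm on `ℝⁿ`. -/
def dualNR {n : ℕ} (N : (Fin n → ℝ) → ℝ) (y : Fin n → ℝ) : ℝ :=
  sSup {r : ℝ | ∃ x, N x ≤ 1 ∧ r = |∑ i, x i * y i|}

/-- The Calderón product norm `X₀^{1-θ}X₁^θ` on `ℝⁿ`. -/
def calNorm {n : ℕ} (θ : ℝ) (N₀ N₁ : (Fin n → ℝ) → ℝ) (f : Fin n → ℝ) : ℝ :=
  sInf {c : ℝ | ∃ g h : Fin n → ℝ, (∀ i, |f i| = |g i| ^ (1 - θ) * |h i| ^ θ) ∧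
    c = N₀ g ^ (1 - θ) * N₁ h ^ θ}

/-- The complex interpolation norm `[N₀,N₁]_θ`, computed via analytic functions
of finite type `z ↦ ∑ φᵢ(z) • vᵢ` on the strip (which, by density, gives the
complex interpolation norm on the intersection for couples with dense intersection). -/
def interpN {D : Type*} [AddCommGroup D] [Module ℂ D]
    (θ : ℝ) (N₀ N₁ : D → ℝ) (x : D) : ℝ :=
  sInf {c : ℝ | ∃ (m : ℕ) (φ : Fin m → ℂ → ℂ) (v : Fin m → D),
    (∀ i, ContinuousOn (φ i) Strip) ∧
    (∀ i, DifferentiableOn ℂ (φ i) OStrip) ∧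
    (∀ i, ∃ B : ℝ, ∀ z ∈ Strip, ‖φ i z‖ ≤ B) ∧
    (∑ i, φ i (θ : ℂ) • v i) = x ∧
    (∀ t : ℝ, N₀ (∑ i, φ i (Complex.I * t) • v i) ≤ c) ∧
    (∀ t : ℝ, N₁ (∑ i, φ i (1 + Complex.I * t) • v i) ≤ c)}

/-- Operator "norm" of a map with respect to given norm functions. -/
def opN {X Y : Type*} (NX : X → ℝ) (NY : Y → ℝ) (T : X → Y) : ℝ :=
  sSup {r : ℝ | ∃ x, NX x ≤ 1 ∧ r = NY (T x)}

/-- The Hilbert space `ℓ₂`. -/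
abbrev Hilb := lp (fun _ : ℕ => ℂ) 2

def hilbNorm (x : Hilb) : ℝ := ‖x‖

/-- `d_θ[M₀,M₁]`: the norm of the identity
`L(ℓ₂,[M₀,M₁]_θ) → [L(ℓ₂,M₀),L(ℓ₂,M₁)]_θ`. -/
def dTheta {V : Type*} [NormedAddCommGroup V] [NormedSpace ℂ V]
    (θ : ℝ) (N₀ N₁ : V → ℝ) : ℝ :=
  sSup {r : ℝ | ∃ T : Hilb →L[ℂ] V,
    opN hilbNorm (interpN θ N₀ N₁) ⇑T ≤ 1 ∧
    r = interpN θ (fun S : Hilb →L[ℂ] V => opN hilbNorm N₀ ⇑S)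
        (fun S : Hilb →L[ℂ] V => opN hilbNorm N₁ ⇑S) T}

/-- Rademacher average `(2^{-m} ∑_ε ‖∑ ±xᵢ‖²)`. -/
def radAvg {V : Type*} [AddCommGroup V] (N : V → ℝ) {m : ℕ} (x : Fin m → V) : ℝ :=
  ((2 : ℝ) ^ m)⁻¹ * ∑ ε : Fin m → Bool, N (∑ i, if ε i then x i else -x i) ^ 2

/-- `N` has (Rademacher) type 2 with constant `C`. -/
def Type2With {V : Type*} [AddCommGroup V] (N : V → ℝ) (C : ℝ) : Prop :=
  ∀ (m : ℕ) (x : Fin m → V), Real.sqrt (radAvg N x) ≤ C * Real.sqrt (∑ i, N (x i) ^ 2)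

/-- `N` has (Rademacher) cotype 2 with constant `C`. -/
def Cotype2With {V : Type*} [AddCommGroup V] (N : V → ℝ) (C : ℝ) : Prop :=
  ∀ (m : ℕ) (x : Fin m → V), Real.sqrt (∑ i, N (x i) ^ 2) ≤ C * Real.sqrt (radAvg N x)

/-- The injective tensor norm of two norm functions. -/
def injN {V W : Type*} [AddCommGroup V] [Module ℂ V] [AddCommGroup W] [Module ℂ W]
    (NV : V → ℝ) (NW : W → ℝ) (z : TensorProduct ℂ V W) : ℝ :=
  sSup {r : ℝ | ∃ (φ : V →ₗ[ℂ] ℂ) (ψ : W →ₗ[ℂ] ℂ),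
    (∀ x, ‖φ x‖ ≤ NV x) ∧ (∀ y, ‖ψ y‖ ≤ NW y) ∧
    r = ‖TensorProduct.lift (((LinearMap.mul ℂ ℂ).comp φ).compl₂ ψ) z‖}

/-- Dual norm on linear functionals. -/
def dualNC {V : Type*} [AddCommGroup V] [Module ℂ V] (N : V → ℝ) (φ : V →ₗ[ℂ] ℂ) : ℝ :=
  sSup {r : ℝ | ∃ x, N x ≤ 1 ∧ r = ‖φ x‖}

/-- The space of bounded linear functionals (dual space of the completion). -/
def BddDual {V : Type*} [AddCommGroup V] [Module ℂ V] (N : V → ℝ) :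
    Submodule ℂ (V →ₗ[ℂ] ℂ) where
  carrier := {φ | ∃ c : ℝ, ∀ x, ‖φ x‖ ≤ c * N x}
  zero_mem' := ⟨0, by simp⟩
  add_mem' := by
    rintro φ ψ ⟨c, hc⟩ ⟨d, hd⟩
    exact ⟨c + d, fun x => by
      have h1 := hc x; have h2 := hd x
      calc ‖(φ + ψ) x‖ = ‖φ x + ψ x‖ := by simp
        _ ≤ ‖φ x‖ + ‖ψ x‖ := norm_add_le _ _
        _ ≤ (c + d) * N x := by rw [add_mul]; exact add_le_add h1 h2⟩
  smul_mem' := by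
    rintro a φ ⟨c, hc⟩
    exact ⟨‖a‖ * c, fun x => by
      have : ‖(a • φ) x‖ = ‖a‖ * ‖φ x‖ := by simp [norm_smul]
      rw [this, mul_assoc]
      exact mul_le_mul_of_nonneg_left (hc x) (norm_nonneg a)⟩

/-- Strictly simple functions with values in `V`: the span of
`v`-valued indicators of finite-measure measurable sets. -/
def SimpleSub {Ω : Type*} [MeasurableSpace Ω] (μ : Measure Ω)
    (V : Type*) [AddCommGroup V] [Module ℂ V] : Submodule ℂ (Ω → V) :=
  Submodule.span ℂ {f | ∃ (s : Set Ω) (v : V), MeasurableSet s ∧ μ s < ⊤ ∧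
    f = s.indicator fun _ => v}

/-- A Banach function space over a measure `μ`, with `K`-valued functions. -/
structure BFS (Ω : Type*) [MeasurableSpace Ω] (μ : Measure Ω) (K : Type*) [RCLike K] where
  mem : (Ω → K) → Prop
  nrm : (Ω → K) → ℝ
  mem_zero : mem 0
  mem_add : ∀ f g, mem f → mem g → mem (f + g)
  mem_smul : ∀ (c : K) (f), mem f → mem (c • f)
  mem_meas : ∀ f, mem f → AEStronglyMeasurable f μ
  ideal : ∀ f g, AEStronglyMeasurable f μ → mem g →
    (∀ᵐ ω ∂μ, ‖f ω‖ ≤ ‖g ω‖) → mem f ∧ nrm f ≤ nrm g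
  nrm_nonneg : ∀ f, 0 ≤ nrm f
  nrm_eq_zero : ∀ f, mem f → nrm f = 0 → f =ᵐ[μ] 0
  nrm_add : ∀ f g, mem f → mem g → nrm (f + g) ≤ nrm f + nrm g
  nrm_smul : ∀ (c : K) (f), nrm (c • f) = ‖c‖ * nrm f
  mem_indicator : ∀ s : Set Ω, MeasurableSet s → μ s < ⊤ →
    mem (s.indicator fun _ => 1)
  complete : ∀ f : ℕ → Ω → K, (∀ k, mem (f k)) →
    (∀ ε : ℝ, 0 < ε → ∃ N : ℕ, ∀ p q, N ≤ p → N ≤ q → nrm (f p - f q) < ε) →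
    ∃ g, mem g ∧ ∀ ε : ℝ, 0 < ε → ∃ N : ℕ, ∀ p, N ≤ p → nrm (f p - g) < ε

variable {Ω : Type*} [MeasurableSpace Ω] {μ : Measure Ω} {K : Type*} [RCLike K]

/-- `X` is `r`-convex with constant `C`. -/
def BFS.RConvexWith (X : BFS Ω μ K) (r C : ℝ) : Prop :=
  ∀ (m : ℕ) (f : Fin m → Ω → K), (∀ i, X.mem (f i)) →
    X.mem (fun ω => ((((∑ i, ‖f i ω‖ ^ r) ^ (1 / r) : ℝ) : K))) ∧
    X.nrm (fun ω => ((((∑ i, ‖f i ω‖ ^ r) ^ (1 / r) : ℝ) : K))) ≤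
      C * (∑ i, X.nrm (f i) ^ r) ^ (1 / r)

/-- `X` is `r`-concave with constant `C`. -/
def BFS.RConcaveWith (X : BFS Ω μ K) (r C : ℝ) : Prop :=
  ∀ (m : ℕ) (f : Fin m → Ω → K), (∀ i, X.mem (f i)) →
    (∑ i, X.nrm (f i) ^ r) ^ (1 / r) ≤
      C * X.nrm (fun ω => ((((∑ i, ‖f i ω‖ ^ r) ^ (1 / r) : ℝ) : K)))

/-- Vector-valued lattice norm `X(E)` on `Eⁿ`. -/
def vecLatNorm {n : ℕ} {V : Type*} (N : (Fin n → ℝ) → ℝ) (NE : V → ℝ)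
    (x : Fin n → V) : ℝ := N fun i => NE (x i)

/-- Bilinear minimax: a convex set of linear forms, each of which reaches the level `r` on the
compact convex set `L`, reaches that level simultaneously at some point of `L`. -/
lemma exists_forall_le_sum_mul {n : ℕ} {L D : Set (Fin n → ℝ)} (hLc : IsCompact L)
    (hL : Convex ℝ L) (hne : L.Nonempty) (hD : Convex ℝ D) (r : ℝ)
    (h : ∀ q ∈ D, ∃ l ∈ L, r ≤ ∑ j, q j * l j) :
    ∃ l ∈ L, ∀ q ∈ D, r ≤ ∑ j, q j * l j := by
  by_contra! hcon
  have hcover : L ⊆ ⋃ q : D, {l : Fin n → ℝ | ∑ j, q.1 j * l j < r} := by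
    intro l hl
    obtain ⟨q, hq, hql⟩ := hcon l hl
    exact Set.mem_iUnion.2 ⟨⟨q, hq⟩, hql⟩
  obtain ⟨s, hs⟩ := hLc.elim_finite_subcover _
    (fun q => isOpen_lt (by fun_prop) continuous_const) hcover
  let Φ : (Fin n → ℝ) → (s → ℝ) := fun l q => ∑ j, q.1.1 j * l j - r
  have hΦ : Continuous Φ := by fun_prop
  have hconv : Convex ℝ (Φ '' L) := by
    rintro _ ⟨l, hl, rfl⟩ _ ⟨l', hl', rfl⟩ a b ha hb hab
    refine ⟨a • l + b • l', hL hl hl' ha hb hab, ?_⟩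
    ext q
    simp only [Φ, Pi.add_apply, Pi.smul_apply, smul_eq_mul, mul_add, Finset.sum_add_distrib,
      mul_sub, Finset.mul_sum]
    have hr : r = a * r + b * r := by rw [← add_mul, hab, one_mul]
    have h1 : ∀ x, q.1.1 x * (a * l x) = a * (q.1.1 x * l x) := fun x => by ring
    have h2 : ∀ x, q.1.1 x * (b * l' x) = b * (q.1.1 x * l' x) := fun x => by ring
    simp only [h1, h2]
    linarith
  have hdisj : Disjoint (Φ '' L) (Set.Ici 0) := by
    rw [Set.disjoint_left]
    rintro _ ⟨l, hl, rfl⟩ hpos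
    obtain ⟨q, hqs, hq⟩ := Set.mem_iUnion₂.1 (hs hl)
    have := hpos ⟨q, hqs⟩
    simp only [Φ, Pi.zero_apply] at this
    simp only [Set.mem_ofPred_eq] at hq
    linarith
  obtain ⟨f, u, v, hfu, huv, hfv⟩ := geometric_hahn_banach_compact_closed hconv
    (hLc.image hΦ) (convex_Ici 0) isClosed_Ici hdisj
  have hv : v < 0 := by simpa using hfv 0 (by simp)
  classical
  let c : s → ℝ := fun q => f (Pi.single q 1)
  have hf : ∀ a, f a = ∑ q, a q * c q := by
    intro a
    conv_lhs => rw [pi_eq_sum_univ' a]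
    simp [c, map_sum]
  have hc : ∀ q, 0 ≤ c q := by
    intro q
    by_contra! hneg
    have := hfv ((v / c q) • Pi.single q 1) (Set.mem_Ici.2
      (smul_nonneg (div_nonneg_of_nonpos hv.le hneg.le) (by simp)))
    rw [map_smul, smul_eq_mul, div_mul_cancel₀ _ hneg.ne] at this
    exact lt_irrefl _ this
  have hcpos : 0 < ∑ q, c q := by
    obtain ⟨l, hl⟩ := hne
    refine lt_of_le_of_ne (Finset.sum_nonneg fun q _ => hc q) fun h0 => ?_
    have h0' := (Finset.sum_eq_zero_iff_of_nonneg fun q _ => hc q).1 h0.symm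
    have := hfu _ ⟨l, hl, rfl⟩
    rw [hf, Finset.sum_eq_zero fun q hq => by rw [h0' q hq, mul_zero]] at this
    linarith
  have hmem : ∑ q, (c q / ∑ q, c q) • (q.1.1 : Fin n → ℝ) ∈ D :=
    hD.sum_mem (fun q _ => div_nonneg (hc q) hcpos.le)
      (by rw [← Finset.sum_div, div_self hcpos.ne']) fun q _ => q.1.2
  obtain ⟨l, hl, hrl⟩ := h _ hmem
  have hneg := (hfu _ ⟨l, hl, rfl⟩).trans (huv.trans hv)
  rw [hf] at hneg
  have hsum : ∑ j, (∑ q, (c q / ∑ q, c q) • (q.1.1 : Fin n → ℝ)) j * l j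
      = (∑ q : s, (∑ j, q.1.1 j * l j) * c q) / ∑ q, c q := by
    simp only [Finset.sum_apply, Pi.smul_apply, smul_eq_mul, Finset.sum_mul, Finset.sum_div]
    rw [Finset.sum_comm]
    refine Finset.sum_congr rfl fun q _ => Finset.sum_congr rfl fun j _ => ?_
    ring
  rw [hsum, le_div_iff₀ hcpos] at hrl
  simp only [Φ, sub_mul, Finset.sum_sub_distrib, ← Finset.mul_sum] at hneg
  linarith

lemma IsLatticeNorm.map_zero {n : ℕ} {N : (Fin n → ℝ) → ℝ} (hN : IsLatticeNorm N) : N 0 = 0 := by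
  simpa using hN.2.2.1 0 0

lemma IsLatticeNorm.map_smul_of_nonneg {n : ℕ} {N : (Fin n → ℝ) → ℝ} (hN : IsLatticeNorm N)
    {c : ℝ} (hc : 0 ≤ c) (x : Fin n → ℝ) : N (fun j => c * x j) = c * N x := by
  have := hN.2.2.1 c x
  rwa [abs_of_nonneg hc] at this

lemma IsLatticeNorm.mono_of_nonneg {n : ℕ} {N : (Fin n → ℝ) → ℝ} (hN : IsLatticeNorm N)
    {x y : Fin n → ℝ} (hx : ∀ j, 0 ≤ x j) (hxy : ∀ j, x j ≤ y j) : N x ≤ N y :=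
  hN.2.2.2.2 x y fun j => by
    rw [abs_of_nonneg (hx j), abs_of_nonneg ((hx j).trans (hxy j))]; exact hxy j

lemma ConcaveWith.sum_sq_le {n : ℕ} {N : (Fin n → ℝ) → ℝ} {M : ℝ}
    (hc : ConcaveWith 2 M N) {ι : Type*} [Fintype ι] (x : ι → Fin n → ℝ) :
    ∑ i, N (x i) ^ 2 ≤ (M * N (fun j => Real.sqrt (∑ i, x i j ^ 2))) ^ 2 := by
  let e := Fintype.equivFin ι
  have h := hc (Fintype.card ι) (fun i => x (e.symm i))
  have h1 : ∑ i, N (x (e.symm i)) ^ (2 : ℝ) = ∑ i, N (x i) ^ 2 := by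
    simp only [Real.rpow_two]
    exact e.symm.sum_comp fun i => N (x i) ^ 2
  have h2 : ∀ j, ∑ i, |x (e.symm i) j| ^ (2 : ℝ) = ∑ i, x i j ^ 2 := by
    intro j
    simp only [Real.rpow_two, sq_abs]
    exact e.symm.sum_comp fun i => x i j ^ 2
  simp only [h1, h2, ← Real.sqrt_eq_rpow] at h
  have h0 : 0 ≤ ∑ i, N (x i) ^ 2 := Finset.sum_nonneg fun i _ => sq_nonneg _
  calc ∑ i, N (x i) ^ 2 = Real.sqrt (∑ i, N (x i) ^ 2) ^ 2 := (Real.sq_sqrt h0).symm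
    _ ≤ _ := pow_le_pow_left₀ (Real.sqrt_nonneg _) h 2

/-- Pietsch domination for the multiplication operator by `g` from `ℓ_∞ⁿ` into a `2`-concave
lattice. -/
lemma exists_pietsch {n : ℕ} {N : (Fin n → ℝ) → ℝ} (hN : IsLatticeNorm N) {M : ℝ} (hM : 0 < M)
    (hc : ConcaveWith 2 M N) {g : Fin n → ℝ} {κ : ℝ} (hκ : 0 < κ) (hg : N g ≤ κ) :
    ∃ l : Fin n → ℝ, (∀ j, 0 ≤ l j) ∧ ∑ j, l j ≤ 1 ∧
      ∀ f : Fin n → ℝ, N (fun j => g j * f j) ^ 2 ≤ (M * κ) ^ 2 * ∑ j, l j * f j ^ 2 := by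
  have hMκ : 0 < M * κ := mul_pos hM hκ
  let L : Set (Fin n → ℝ) := {l | (∀ j, 0 ≤ l j) ∧ ∑ j, l j ≤ 1}
  have hLc : IsCompact L := by
    refine (isCompact_Icc (a := (0 : Fin n → ℝ)) (b := 1)).of_isClosed_subset ?_ ?_
    · refine IsClosed.inter ?_ (isClosed_le (f := fun l : Fin n → ℝ => ∑ j, l j)
        (by fun_prop) continuous_const)
      exact isClosed_Ici (a := (0 : Fin n → ℝ))
    · rintro l ⟨h0, h1⟩
      exact ⟨h0, fun j => (Finset.single_le_sum (fun i _ => h0 i) (Finset.mem_univ j)).trans h1⟩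
  have hL : Convex ℝ L := by
    rintro l ⟨h0, h1⟩ l' ⟨h0', h1'⟩ a b ha hb hab
    refine ⟨fun j => ?_, ?_⟩
    · have := mul_nonneg ha (h0 j); have := mul_nonneg hb (h0' j)
      simp only [Pi.add_apply, Pi.smul_apply, smul_eq_mul]; positivity
    · simp only [Pi.add_apply, Pi.smul_apply, smul_eq_mul, Finset.sum_add_distrib,
        ← Finset.mul_sum]
      nlinarith
  let D : Set (Fin n → ℝ) :=
    {q | ∃ f : Fin n → ℝ, N (fun j => g j * f j) = 1 ∧ q = fun j => f j ^ 2}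
  have key : ∀ q ∈ convexHull ℝ D, ∃ l ∈ L, ((M * κ) ^ 2)⁻¹ ≤ ∑ j, q j * l j := by
    intro q hq
    obtain ⟨ι, _, w, z, hw, hw1, hz, rfl⟩ := mem_convexHull_iff_exists_fintype.1 hq
    choose f hf hzf using hz
    have hconc := hc.sum_sq_le fun i j => Real.sqrt (w i) * (g j * f i j)
    have hleft : ∑ i, N (fun j => Real.sqrt (w i) * (g j * f i j)) ^ 2 = 1 := by
      rw [← hw1]
      refine Finset.sum_congr rfl fun i _ => ?_
      rw [hN.map_smul_of_nonneg (Real.sqrt_nonneg _), hf i, mul_one, Real.sq_sqrt (hw i)]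
    set q : Fin n → ℝ := ∑ i, w i • z i with hqdef
    have hqj : ∀ j, q j = ∑ i, w i * f i j ^ 2 := fun j => by simp [hqdef, hzf]
    have hq0 : ∀ j, 0 ≤ q j := fun j => by
      rw [hqj]; exact Finset.sum_nonneg fun i _ => mul_nonneg (hw i) (sq_nonneg _)
    have hright : ∀ j, Real.sqrt (∑ i, (Real.sqrt (w i) * (g j * f i j)) ^ 2)
        = |g j| * Real.sqrt (q j) := by
      intro j
      rw [← Real.sqrt_sq_eq_abs, ← Real.sqrt_mul (sq_nonneg _), hqj, Finset.mul_sum]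
      congr 1
      refine Finset.sum_congr rfl fun i _ => ?_
      rw [mul_pow, Real.sq_sqrt (hw i)]; ring
    simp only [hleft, hright] at hconc
    rcases isEmpty_or_nonempty (Fin n) with hn | hn
    · have h0 : (fun j => |g j| * Real.sqrt (q j)) = 0 := Subsingleton.elim _ _
      rw [h0, hN.map_zero] at hconc
      norm_num at hconc
    obtain ⟨j₀, hj₀⟩ := Finite.exists_max q
    refine ⟨Pi.single j₀ 1, ⟨fun j => ?_, by simp⟩, ?_⟩
    · by_cases h : j = j₀
      · subst h; simp
      · simp [h]
    have hle : N (fun j => |g j| * Real.sqrt (q j)) ≤ Real.sqrt (q j₀) * κ := by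
      refine le_trans ?_ (mul_le_mul_of_nonneg_left hg (Real.sqrt_nonneg _))
      rw [← hN.map_smul_of_nonneg (Real.sqrt_nonneg _)]
      refine hN.2.2.2.2 _ _ fun j => ?_
      rw [abs_mul, abs_mul, abs_abs, abs_of_nonneg (Real.sqrt_nonneg _),
        abs_of_nonneg (Real.sqrt_nonneg _), mul_comm]
      exact mul_le_mul_of_nonneg_right (Real.sqrt_le_sqrt (hj₀ j)) (abs_nonneg _)
    have h1 : (1 : ℝ) ≤ (M * κ) ^ 2 * q j₀ := by
      calc (1 : ℝ) ≤ (M * N (fun j => |g j| * Real.sqrt (q j))) ^ 2 := hconc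
        _ ≤ (M * (Real.sqrt (q j₀) * κ)) ^ 2 :=
          pow_le_pow_left₀ (mul_nonneg hM.le (hN.1 _)) (mul_le_mul_of_nonneg_left hle hM.le) 2
        _ = (M * κ) ^ 2 * q j₀ := by
          rw [mul_pow, mul_pow, Real.sq_sqrt (hq0 _)]; ring
    simp only [Pi.single_apply, mul_ite, mul_one, mul_zero, Finset.sum_ite_eq', Finset.mem_univ,
      if_true]
    rwa [inv_le_iff_one_le_mul₀' (by positivity)]
  obtain ⟨l, hl, hlD⟩ := exists_forall_le_sum_mul hLc hL ⟨0, by simp, by simp⟩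
    (convex_convexHull ℝ D) _ key
  refine ⟨l, hl.1, hl.2, fun f => ?_⟩
  have hsum0 : 0 ≤ ∑ j, l j * f j ^ 2 :=
    Finset.sum_nonneg fun j _ => mul_nonneg (hl.1 j) (sq_nonneg _)
  rcases (hN.1 fun j => g j * f j).eq_or_lt with h0 | hpos
  · rw [← h0, zero_pow two_ne_zero]
    exact mul_nonneg (sq_nonneg _) hsum0
  set ν := N fun j => g j * f j with hν
  have hmem : (fun j => (ν⁻¹ * f j) ^ 2) ∈ D := by
    refine ⟨fun j => ν⁻¹ * f j, ?_, rfl⟩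
    have : (fun j => g j * (ν⁻¹ * f j)) = fun j => ν⁻¹ * (g j * f j) := by ext j; ring
    rw [this, hN.map_smul_of_nonneg (inv_nonneg.2 hpos.le), ← hν, inv_mul_cancel₀ hpos.ne']
  have h := hlD _ (subset_convexHull ℝ D hmem)
  have hs : ∑ j, (ν⁻¹ * f j) ^ 2 * l j = (ν ^ 2)⁻¹ * ∑ j, l j * f j ^ 2 := by
    rw [Finset.mul_sum]
    refine Finset.sum_congr rfl fun j _ => ?_
    rw [mul_pow, inv_pow]; ring
  rw [hs] at h
  have hν2 : 0 < ν ^ 2 := by positivity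
  have hMκ2 : 0 < (M * κ) ^ 2 := by positivity
  rw [inv_le_iff_one_le_mul₀' hMκ2] at h
  calc ν ^ 2 = ν ^ 2 * 1 := (mul_one _).symm
    _ ≤ ν ^ 2 * ((M * κ) ^ 2 * ((ν ^ 2)⁻¹ * ∑ j, l j * f j ^ 2)) :=
      mul_le_mul_of_nonneg_left h hν2.le
    _ = _ := by field_simp

/-- Every strictly positive element of a `2`-concave lattice factors through a multiplication
operator `ℓ₂ⁿ → X`. The logarithm `s` of the squared multiplier is the parameter. -/
lemma exists_multiplier {n : ℕ} {N : (Fin n → ℝ) → ℝ} (hN : IsLatticeNorm N) {M : ℝ} (hM : 0 < M)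
    (hc : ConcaveWith 2 M N) {g : Fin n → ℝ} (hgpos : ∀ j, 0 < g j) {κ : ℝ} (hκ : 0 < κ)
    (hg : N g ≤ κ) :
    ∃ s : Fin n → ℝ,
      (∀ f : Fin n → ℝ, N (fun j => Real.exp (s j / 2) * f j) ^ 2 ≤ ∑ j, f j ^ 2) ∧
      ∑ j, g j ^ 2 * Real.exp (-s j) ≤ (M * κ) ^ 2 := by
  obtain ⟨l, hl0, hl1, hl⟩ := exists_pietsch hN hM hc hκ hg
  have hMκ : 0 < M * κ := mul_pos hM hκ
  have hlpos : ∀ j, 0 < l j := by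
    intro j
    refine lt_of_le_of_ne (hl0 j) fun h0 => ?_
    have h := hl (Pi.single j 1)
    have hz : ∑ i, l i * (Pi.single j 1 : Fin n → ℝ) i ^ 2 = 0 := by
      refine Finset.sum_eq_zero fun i _ => ?_
      by_cases hij : i = j
      · subst hij; rw [← h0]; simp
      · simp [hij]
    rw [hz, mul_zero] at h
    have h' := hN.2.1 _ (pow_eq_zero_iff two_ne_zero |>.1 (le_antisymm h (sq_nonneg _)))
    have := congrFun h' j
    simp [(hgpos j).ne'] at this
  have hexp : ∀ j, Real.exp (Real.log (g j ^ 2 / (l j * (M * κ) ^ 2)))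
      = g j ^ 2 / (l j * (M * κ) ^ 2) := fun j => Real.exp_log (by
    have := hgpos j; have := hlpos j; positivity)
  have hsqrt : ∀ j, Real.exp (Real.log (g j ^ 2 / (l j * (M * κ) ^ 2)) / 2)
      = g j / (Real.sqrt (l j) * (M * κ)) := by
    intro j
    rw [Real.exp_half, hexp, Real.sqrt_div (sq_nonneg _), Real.sqrt_mul (hl0 j),
      Real.sqrt_sq (hgpos j).le, Real.sqrt_sq hMκ.le]
  refine ⟨fun j => Real.log (g j ^ 2 / (l j * (M * κ) ^ 2)), fun f => ?_, ?_⟩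
  · simp only [hsqrt]
    have h := hl fun j => f j / (Real.sqrt (l j) * (M * κ))
    have h1 : (fun j => g j / (Real.sqrt (l j) * (M * κ)) * f j)
        = fun j => g j * (f j / (Real.sqrt (l j) * (M * κ))) := by ext j; ring
    rw [h1]
    refine h.trans (le_of_eq ?_)
    rw [Finset.mul_sum]
    refine Finset.sum_congr rfl fun j _ => ?_
    have := hlpos j
    rw [div_pow, mul_pow (Real.sqrt (l j)), Real.sq_sqrt (hl0 j)]
    field_simp
  · have : ∀ j, g j ^ 2 * Real.exp (-Real.log (g j ^ 2 / (l j * (M * κ) ^ 2)))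
        = (M * κ) ^ 2 * l j := by
      intro j
      have := hlpos j; have := hgpos j
      rw [Real.exp_neg, hexp]; field_simp
    simp only [this, ← Finset.mul_sum]
    exact mul_le_of_le_one_right (sq_nonneg _) hl1

/-- Walsh functions on the discrete cube. -/
def walsh {m : ℕ} (A : Finset (Fin m)) (ε : Fin m → Bool) : ℝ :=
  ∏ i ∈ A, if ε i then 1 else -1

/-- Unnormalised Walsh coefficients. -/
def walshCoeff {m : ℕ} (h : (Fin m → Bool) → ℝ) (A : Finset (Fin m)) : ℝ :=
  ∑ ε, h ε * walsh A ε

lemma sum_walsh_mul_walsh {m : ℕ} (ε η : Fin m → Bool) :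
    ∑ A : Finset (Fin m), walsh A ε * walsh A η = if ε = η then (2 : ℝ) ^ m else 0 := by
  have h : ∑ A : Finset (Fin m), walsh A ε * walsh A η
      = ∏ i, (1 + (if ε i then (1 : ℝ) else -1) * (if η i then 1 else -1)) := by
    rw [Finset.prod_one_add, Finset.powerset_univ]
    simp only [walsh, Finset.prod_mul_distrib]
  rw [h]
  split_ifs with he
  · subst he
    have : ∀ i, (1 + (if ε i then (1 : ℝ) else -1) * (if ε i then 1 else -1)) = 2 := by
      intro i; split_ifs <;> norm_num
    rw [Finset.prod_congr rfl fun i _ => this i]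
    simp
  · obtain ⟨i, hi⟩ := Function.ne_iff.1 he
    refine Finset.prod_eq_zero (Finset.mem_univ i) ?_
    revert hi
    cases ε i <;> cases η i <;> simp

lemma sum_walshCoeff_mul {m : ℕ} (h g : (Fin m → Bool) → ℝ) :
    ∑ A, walshCoeff h A * walshCoeff g A = 2 ^ m * ∑ ε, h ε * g ε := by
  have h1 : ∑ A, walshCoeff h A * walshCoeff g A
      = ∑ ε, ∑ η, h ε * g η * ∑ A : Finset (Fin m), walsh A ε * walsh A η := by
    simp only [walshCoeff, Finset.sum_mul_sum]
    rw [Finset.sum_comm]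
    refine Finset.sum_congr rfl fun ε _ => ?_
    rw [Finset.sum_comm]
    refine Finset.sum_congr rfl fun η _ => ?_
    rw [Finset.mul_sum]
    exact Finset.sum_congr rfl fun A _ => by ring
  rw [h1, Finset.mul_sum]
  refine Finset.sum_congr rfl fun ε _ => ?_
  simp only [sum_walsh_mul_walsh, mul_ite, mul_zero, Finset.sum_ite_eq, Finset.mem_univ, if_true]
  ring

/-- Flip the `i`-th coordinate. -/
def flipAt {m : ℕ} (i : Fin m) (ε : Fin m → Bool) : Fin m → Bool :=
  Function.update ε i (!ε i)

lemma flipAt_involutive {m : ℕ} (i : Fin m) : Function.Involutive (flipAt i) := by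
  intro ε
  simp [flipAt]

lemma walsh_flipAt {m : ℕ} (A : Finset (Fin m)) (i : Fin m) (ε : Fin m → Bool) :
    walsh A (flipAt i ε) = (if i ∈ A then -1 else 1) * walsh A ε := by
  have hne : ∀ j ∈ A.erase i, flipAt i ε j = ε j := fun j hj => by
    simp [flipAt, Finset.ne_of_mem_erase hj]
  unfold walsh
  split_ifs with hi
  · rw [← Finset.mul_prod_erase _ _ hi, ← Finset.mul_prod_erase _ _ hi,
      Finset.prod_congr rfl fun j hj => by rw [hne j hj]]
    have : flipAt i ε i = !ε i := by simp [flipAt]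
    rw [this]
    cases ε i <;> simp
  · rw [Finset.erase_eq_of_notMem hi] at hne
    rw [one_mul]
    exact Finset.prod_congr rfl fun j hj => by rw [hne j hj]

lemma walshCoeff_laplacian {m : ℕ} (h : (Fin m → Bool) → ℝ) (A : Finset (Fin m)) :
    walshCoeff (fun ε => ∑ i, (h ε - h (flipAt i ε))) A = 2 * (A.card : ℝ) * walshCoeff h A := by
  have hflip : ∀ i, ∑ ε, h (flipAt i ε) * walsh A ε
      = (if i ∈ A then -1 else 1) * walshCoeff h A := by
    intro i
    rw [← (flipAt_involutive i).bijective.sum_comp, walshCoeff, Finset.mul_sum]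
    refine Finset.sum_congr rfl fun ε _ => ?_
    rw [flipAt_involutive i, walsh_flipAt]; ring
  calc walshCoeff (fun ε => ∑ i, (h ε - h (flipAt i ε))) A
      = ∑ i, (walshCoeff h A - ∑ ε, h (flipAt i ε) * walsh A ε) := by
        simp only [walshCoeff, Finset.sum_mul]
        rw [Finset.sum_comm]
        refine Finset.sum_congr rfl fun i _ => ?_
        rw [← Finset.sum_sub_distrib]
        exact Finset.sum_congr rfl fun ε _ => by ring
    _ = ∑ i, if i ∈ A then 2 * walshCoeff h A else 0 := by
        refine Finset.sum_congr rfl fun i _ => ?_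
        rw [hflip]
        split_ifs <;> ring
    _ = _ := by
        rw [Finset.sum_ite_mem, Finset.univ_inter, Finset.sum_const, nsmul_eq_mul]; ring

lemma walshCoeff_eq_zero_of_even {m : ℕ} {h : (Fin m → Bool) → ℝ}
    (heven : ∀ ε, h (fun i => !ε i) = h ε) {A : Finset (Fin m)} (hA : A.card = 1) :
    walshCoeff h A = 0 := by
  obtain ⟨i, rfl⟩ := Finset.card_eq_one.1 hA
  have hinv : Function.Involutive fun (ε : Fin m → Bool) => fun i => !ε i := fun ε => by simp
  have : walshCoeff h {i} = -walshCoeff h {i} := by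
    conv_lhs => rw [walshCoeff, ← hinv.bijective.sum_comp]
    rw [walshCoeff, ← Finset.sum_neg_distrib]
    refine Finset.sum_congr rfl fun ε _ => ?_
    rw [heven]
    simp only [walsh, Finset.prod_singleton]
    rcases Bool.eq_false_or_eq_true (ε i) with hi | hi <;> simp [hi]
  linarith

/-- Latała–Oleszkiewicz: Kahane's inequality between the first and second moments of
Rademacher sums with the optimal constant `√2`. -/
lemma sum_sq_le_two_mul_sq_sum {V : Type*} [AddCommGroup V] [Module ℂ V] {N : V → ℝ}
    (hN : IsNormC N) {m : ℕ} (x : Fin m → V) :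
    (2 : ℝ) ^ m * ∑ ε : Fin m → Bool, N (∑ i, if ε i then x i else -x i) ^ 2 ≤
      2 * (∑ ε : Fin m → Bool, N (∑ i, if ε i then x i else -x i)) ^ 2 := by
  obtain ⟨h0, -, hsmul, hadd⟩ := hN
  have hneg : ∀ v, N (-v) = N v := fun v => by simpa using hsmul (-1) v
  have hzero : N 0 = 0 := by simpa using hsmul 0 0
  have hsum : ∀ f : Fin m → V, N (∑ i, f i) ≤ ∑ i, N (f i) := fun f =>
    Finset.le_sum_of_subadditive N hzero.le hadd _ _
  set S : (Fin m → Bool) → V := fun ε => ∑ i, if ε i then x i else -x i with hS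
  set h : (Fin m → Bool) → ℝ := fun ε => N (S ε) with hh
  have heven : ∀ ε, h (fun i => !ε i) = h ε := by
    intro ε
    have : S (fun i => !ε i) = -S ε := by
      simp only [hS, ← Finset.sum_neg_distrib]
      refine Finset.sum_congr rfl fun i _ => ?_
      rcases Bool.eq_false_or_eq_true (ε i) with hi | hi <;> simp [hi]
    simp only [hh, this, hneg]
  have hS_flip : ∀ ε i, S (flipAt i ε) = S ε - (2 : ℂ) • (if ε i then x i else -x i) := by
    intro ε i
    have h1 : ∀ η : Fin m → Bool, S η = (if η i then x i else -x i)
        + ∑ j ∈ Finset.univ.erase i, if η j then x j else -x j := fun η =>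
      (Finset.add_sum_erase _ _ (Finset.mem_univ i)).symm
    have h2 : ∑ j ∈ Finset.univ.erase i, (if flipAt i ε j then x j else -x j)
        = ∑ j ∈ Finset.univ.erase i, if ε j then x j else -x j :=
      Finset.sum_congr rfl fun j hj => by simp [flipAt, Finset.ne_of_mem_erase hj]
    rw [h1, h1 ε, h2]
    have : flipAt i ε i = !ε i := by simp [flipAt]
    rw [this, two_smul]
    generalize ∑ j ∈ Finset.univ.erase i, (if ε j then x j else -x j) = R
    rcases Bool.eq_false_or_eq_true (ε i) with hi | hi <;> simp [hi] <;> abel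
  have hlap : ∀ ε, ∑ i, (h ε - h (flipAt i ε)) ≤ 2 * h ε := by
    intro ε
    have h1 : ∑ i, S (flipAt i ε) = ((m : ℂ) - 2) • S ε := by
      simp only [hS_flip, Finset.sum_sub_distrib, ← Finset.smul_sum]
      rw [Finset.sum_const, Finset.card_univ, Fintype.card_fin, sub_smul, Nat.cast_smul_eq_nsmul]
    have h2 : ((m : ℝ) - 2) * h ε ≤ ∑ i, h (flipAt i ε) := by
      have := hsum fun i => S (flipAt i ε)
      rw [h1, hsmul] at this
      refine le_trans (mul_le_mul_of_nonneg_right ?_ (h0 _)) this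
      have h3 : ((m : ℂ) - 2) = (((m : ℝ) - 2 : ℝ) : ℂ) := by push_cast; ring
      rw [h3, Complex.norm_real]
      exact le_abs_self _
    rw [Finset.sum_sub_distrib, Finset.sum_const, Finset.card_univ, Fintype.card_fin,
      nsmul_eq_mul]
    linarith
  have hP : ∑ A, walshCoeff h A * walshCoeff h A = 2 ^ m * ∑ ε, h ε ^ 2 := by
    rw [sum_walshCoeff_mul]; simp only [sq]
  have hQ : ∑ A : Finset (Fin m), 2 * (A.card : ℝ) * (walshCoeff h A * walshCoeff h A)
      ≤ 2 * (2 ^ m * ∑ ε, h ε ^ 2) := by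
    have h1 := sum_walshCoeff_mul h fun ε => ∑ i, (h ε - h (flipAt i ε))
    have h2 : ∑ A : Finset (Fin m), 2 * (A.card : ℝ) * (walshCoeff h A * walshCoeff h A)
        = 2 ^ m * ∑ ε, h ε * ∑ i, (h ε - h (flipAt i ε)) := by
      rw [← h1]
      exact Finset.sum_congr rfl fun A _ => by rw [walshCoeff_laplacian]; ring
    rw [h2, mul_left_comm]
    refine mul_le_mul_of_nonneg_left ?_ (by positivity)
    rw [Finset.mul_sum]
    refine Finset.sum_le_sum fun ε _ => ?_
    nlinarith [hlap ε, h0 (S ε)]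
  have hR : 4 * (∑ A, walshCoeff h A * walshCoeff h A - walshCoeff h ∅ * walshCoeff h ∅)
      ≤ ∑ A : Finset (Fin m), 2 * (A.card : ℝ) * (walshCoeff h A * walshCoeff h A) := by
    rw [← Finset.add_sum_erase _ (fun A => walshCoeff h A * walshCoeff h A)
      (Finset.mem_univ (∅ : Finset (Fin m))), ← Finset.add_sum_erase _
      (fun A : Finset (Fin m) => 2 * (A.card : ℝ) * (walshCoeff h A * walshCoeff h A))
      (Finset.mem_univ (∅ : Finset (Fin m)))]
    simp only [add_sub_cancel_left, Finset.card_empty, Nat.cast_zero, mul_zero, zero_mul, zero_add,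
      Finset.mul_sum]
    refine Finset.sum_le_sum fun A hA => ?_
    have hpos : 0 < A.card := Finset.card_pos.2
      (Finset.nonempty_iff_ne_empty.2 (Finset.ne_of_mem_erase hA))
    rcases Nat.lt_or_ge A.card 2 with h2 | h2
    · rw [walshCoeff_eq_zero_of_even heven (by omega)]; simp
    · have : (2 : ℝ) ≤ A.card := by exact_mod_cast h2
      nlinarith [mul_self_nonneg (walshCoeff h A)]
  have hE : walshCoeff h ∅ = ∑ ε, h ε := by simp [walshCoeff, walsh]
  rw [hE] at hR
  rw [hP] at hR
  nlinarith

/-- The three lines theorem on `Strip`. -/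
lemma norm_le_exp_of_strip {θ : ℝ} (hθ : 0 < θ) (hθ1 : θ < 1) {F : ℂ → ℂ}
    (hc : ContinuousOn F Strip) (hd : DifferentiableOn ℂ F OStrip)
    (hb : ∃ B : ℝ, ∀ z ∈ Strip, ‖F z‖ ≤ B) {A B : ℝ}
    (h0 : ∀ t : ℝ, ‖F (Complex.I * t)‖ ≤ Real.exp A)
    (h1 : ∀ t : ℝ, ‖F (1 + Complex.I * t)‖ ≤ Real.exp B) :
    ‖F (θ : ℂ)‖ ≤ Real.exp ((1 - θ) * A + θ * B) := by
  have hcl : closure (Complex.HadamardThreeLines.verticalStrip 0 1) = Strip := by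
    rw [Complex.HadamardThreeLines.verticalStrip, Complex.closure_preimage_re,
      closure_Ioo zero_ne_one]
    rfl
  have hdc : DiffContOnCl ℂ F (Complex.HadamardThreeLines.verticalStrip 0 1) :=
    ⟨hd, by rwa [hcl]⟩
  obtain ⟨K, hK⟩ := hb
  have h := Complex.HadamardThreeLines.norm_le_interp_of_mem_verticalClosedStrip₀₁' F
    (z := (θ : ℂ)) (a := Real.exp A) (b := Real.exp B)
    (by simp [Complex.HadamardThreeLines.verticalClosedStrip, hθ.le, hθ1.le]) hdc
    ⟨K, by rintro _ ⟨z, hz, rfl⟩; exact hK z hz⟩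
    (fun z hz => by
      have : z = Complex.I * (z.im : ℝ) := Complex.ext (by simpa using hz) (by simp)
      rw [this]; exact h0 _)
    (fun z hz => by
      have : z = 1 + Complex.I * (z.im : ℝ) := Complex.ext (by simpa using hz) (by simp)
      rw [this]; exact h1 _)
  rw [Complex.ofReal_re, ← Real.exp_mul, ← Real.exp_mul, ← Real.exp_add] at h
  rwa [mul_comm (1 - θ), mul_comm θ]

lemma IsLatticeNorm.convex_exp_lt {n : ℕ} {N : (Fin n → ℝ) → ℝ} (hN : IsLatticeNorm N) (κ : ℝ) :
    Convex ℝ {G : Fin n → ℝ | N (fun j => Real.exp (G j)) < κ} := by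
  intro G hG G' hG' a b ha hb hab
  have h1 : N (fun j => Real.exp ((a • G + b • G') j))
      ≤ N ((fun j => a * Real.exp (G j)) + fun j => b * Real.exp (G' j)) := by
    refine hN.mono_of_nonneg (fun j => (Real.exp_pos _).le) fun j => ?_
    have := convexOn_exp.2 (Set.mem_univ (G j)) (Set.mem_univ (G' j)) ha hb hab
    simpa using this
  have h2 := hN.2.2.2.1 (fun j => a * Real.exp (G j)) fun j => b * Real.exp (G' j)
  rw [hN.map_smul_of_nonneg ha, hN.map_smul_of_nonneg hb] at h2
  simp only [Set.mem_ofPred_eq] at hG hG' ⊢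
  refine (h1.trans h2).trans_lt ?_
  rcases ha.eq_or_lt with rfl | ha'
  · have : b = 1 := by linarith
    subst this; linarith
  · have h3 : κ = a * κ + b * κ := by rw [← add_mul, hab, one_mul]
    nlinarith

lemma IsLatticeNorm.exp_add_const {n : ℕ} {N : (Fin n → ℝ) → ℝ} (hN : IsLatticeNorm N)
    (G : Fin n → ℝ) (d : ℝ) :
    N (fun j => Real.exp (G j + d)) = Real.exp d * N fun j => Real.exp (G j) := by
  rw [← hN.map_smul_of_nonneg (Real.exp_pos d).le]
  congr 1; ext j; rw [Real.exp_add, mul_comm]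

lemma IsLatticeNorm.exp_mono {n : ℕ} {N : (Fin n → ℝ) → ℝ} (hN : IsLatticeNorm N)
    {G G' : Fin n → ℝ} (h : ∀ j, G j ≤ G' j) :
    N (fun j => Real.exp (G j)) ≤ N fun j => Real.exp (G' j) :=
  hN.mono_of_nonneg (fun _ => (Real.exp_pos _).le) fun j => Real.exp_le_exp.2 (h j)

/-- In logarithmic coordinates, the open ball of radius `κ` of the Calderón product
`X₀^{1-θ}X₁^θ`. -/
def calLog {n : ℕ} (θ κ : ℝ) (N₀ N₁ : (Fin n → ℝ) → ℝ) : Set (Fin n → ℝ) :=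
  {γ | ∃ G H : Fin n → ℝ, N₀ (fun j => Real.exp (G j)) < κ ∧ N₁ (fun j => Real.exp (H j)) < κ ∧
    γ = (1 - θ) • G + θ • H}

lemma exists_pos_exp_mul_lt {a κ : ℝ} (h : a < κ) : ∃ d > 0, Real.exp d * a < κ := by
  have hcont : Filter.Tendsto (fun d : ℝ => Real.exp d * a) (nhds 0) (nhds (Real.exp 0 * a)) :=
    (Real.continuous_exp.mul continuous_const).tendsto 0
  rw [Real.exp_zero, one_mul] at hcont
  obtain ⟨ε, hε, hball⟩ := Metric.eventually_nhds_iff.1 (hcont.eventually_lt_const h)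
  refine ⟨ε / 2, by positivity, hball ?_⟩
  rw [Real.dist_eq, sub_zero, abs_of_pos (by positivity)]
  linarith

lemma calLog_add {n : ℕ} {θ κ : ℝ} {N₀ N₁ : (Fin n → ℝ) → ℝ} {G H v : Fin n → ℝ}
    (hG : N₀ (fun j => Real.exp (G j + v j)) < κ) (hH : N₁ (fun j => Real.exp (H j + v j)) < κ) :
    (1 - θ) • G + θ • H + v ∈ calLog θ κ N₀ N₁ := by
  refine ⟨G + v, H + v, hG, hH, ?_⟩
  ext j
  simp only [Pi.add_apply, Pi.smul_apply, smul_eq_mul]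
  ring

lemma convex_calLog {n : ℕ} (θ κ : ℝ) {N₀ N₁ : (Fin n → ℝ) → ℝ} (h₀ : IsLatticeNorm N₀)
    (h₁ : IsLatticeNorm N₁) : Convex ℝ (calLog θ κ N₀ N₁) := by
  rintro _ ⟨G, H, hG, hH, rfl⟩ _ ⟨G', H', hG', hH', rfl⟩ a b ha hb hab
  refine ⟨a • G + b • G', a • H + b • H', h₀.convex_exp_lt κ hG hG' ha hb hab,
    h₁.convex_exp_lt κ hH hH' ha hb hab, ?_⟩
  module

lemma isOpen_calLog {n : ℕ} (θ κ : ℝ) {N₀ N₁ : (Fin n → ℝ) → ℝ} (h₀ : IsLatticeNorm N₀)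
    (h₁ : IsLatticeNorm N₁) : IsOpen (calLog θ κ N₀ N₁) := by
  rw [Metric.isOpen_iff]
  rintro _ ⟨G, H, hG, hH, rfl⟩
  obtain ⟨d₀, hd₀, hd₀'⟩ := exists_pos_exp_mul_lt hG
  obtain ⟨d₁, hd₁, hd₁'⟩ := exists_pos_exp_mul_lt hH
  refine ⟨min d₀ d₁, lt_min hd₀ hd₁, fun γ hγ => ?_⟩
  have hv : ∀ j, (γ - ((1 - θ) • G + θ • H)) j ≤ min d₀ d₁ := fun j =>
    (le_abs_self _).trans ((norm_le_pi_norm (γ - ((1 - θ) • G + θ • H)) j).trans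
      (mem_ball_iff_norm.1 hγ).le)
  rw [show γ = (1 - θ) • G + θ • H + (γ - ((1 - θ) • G + θ • H)) by abel]
  refine calLog_add ?_ ?_
  · rw [← h₀.exp_add_const] at hd₀'
    exact (h₀.exp_mono fun j => by have := (hv j).trans (min_le_left _ _); linarith).trans_lt hd₀'
  · rw [← h₁.exp_add_const] at hd₁'
    exact (h₁.exp_mono fun j => by have := (hv j).trans (min_le_right _ _); linarith).trans_lt hd₁'

/-- Calderón: an analytic family on the strip whose boundary values lie in the balls of radius `c`
of `X₀` and `X₁` takes at `θ` a value in the Calderón product. -/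
lemma log_norm_mem_calLog {n : ℕ} {θ : ℝ} (hθ : 0 < θ) (hθ1 : θ < 1) {N₀ N₁ : (Fin n → ℝ) → ℝ}
    (h₀ : IsLatticeNorm N₀) (h₁ : IsLatticeNorm N₁) {f : Fin n → ℂ → ℂ}
    (hfc : ∀ j, ContinuousOn (f j) Strip) (hfd : ∀ j, DifferentiableOn ℂ (f j) OStrip)
    (hfb : ∀ j, ∃ B : ℝ, ∀ z ∈ Strip, ‖f j z‖ ≤ B) {c κ : ℝ} (hc : 0 ≤ c) (hcκ : c < κ)
    (hf₀ : ∀ t : ℝ, N₀ (fun j => ‖f j (Complex.I * t)‖) ≤ c)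
    (hf₁ : ∀ t : ℝ, N₁ (fun j => ‖f j (1 + Complex.I * t)‖) ≤ c)
    (hpos : ∀ j, f j (θ : ℂ) ≠ 0) :
    (fun j => Real.log ‖f j (θ : ℂ)‖) ∈ calLog θ κ N₀ N₁ := by
  by_contra hmem
  set b : Fin n → ℝ := fun j => Real.log ‖f j (θ : ℂ)‖ with hb
  obtain ⟨φ, hφ⟩ := geometric_hahn_banach_open_point (convex_calLog θ κ h₀ h₁)
    (isOpen_calLog θ κ h₀ h₁) hmem
  set y : Fin n → ℝ := fun j => φ (Pi.single j 1) with hy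
  have hφy : ∀ a, φ a = ∑ j, a j * y j := by
    intro a
    conv_lhs => rw [pi_eq_sum_univ' a]
    simp [hy, map_sum]
  -- room for a perturbation of the boundary values
  obtain ⟨κ', hcκ', hκ'κ⟩ := exists_between hcκ
  have hκ' : 0 < κ' := hc.trans_lt hcκ'
  obtain ⟨d, hd, hdκ⟩ := exists_pos_exp_mul_lt hκ'κ
  set δ : ℝ := (κ' - c) / (N₀ 1 + N₁ 1 + 1) with hδdef
  have hden : 0 < N₀ 1 + N₁ 1 + 1 := by have := h₀.1 1; have := h₁.1 1; linarith
  have hδ : 0 < δ := div_pos (by linarith) hden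
  have hδκ : δ * (N₀ 1 + N₁ 1 + 1) = κ' - c := div_mul_cancel₀ _ hden.ne'
  set G : ℝ → Fin n → ℝ := fun t j => Real.log (‖f j (Complex.I * t)‖ + δ) with hG
  set H : ℝ → Fin n → ℝ := fun t j => Real.log (‖f j (1 + Complex.I * t)‖ + δ) with hH
  have hperturb : ∀ {N : (Fin n → ℝ) → ℝ}, IsLatticeNorm N → N 1 ≤ N₀ 1 + N₁ 1 →
      ∀ x : Fin n → ℝ, (∀ j, 0 ≤ x j) → N x ≤ c →
      N (fun j => Real.exp (Real.log (x j + δ) + d)) < κ := by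
    intro N hN hN1 x hx hxc
    rw [hN.exp_add_const]
    refine lt_of_le_of_lt (mul_le_mul_of_nonneg_left ?_ (Real.exp_pos d).le) hdκ
    have h1 : (fun j => Real.exp (Real.log (x j + δ))) = x + δ • (1 : Fin n → ℝ) := by
      ext j
      have := hx j
      rw [Real.exp_log (by linarith)]; simp
    rw [h1]
    refine (hN.2.2.2.1 _ _).trans ?_
    rw [hN.2.2.1, abs_of_pos hδ]
    nlinarith
  have hGH : ∀ t t', ∑ j, ((1 - θ) * G t j + θ * H t' j) * y j + d * ∑ j, y j
      < ∑ j, b j * y j := by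
    intro t t'
    have := hφ _ (calLog_add (θ := θ) (κ := κ) (N₀ := N₀) (N₁ := N₁) (G := G t) (H := H t')
      (v := fun _ => d)
      (hperturb h₀ (by have := h₁.1 1; linarith) _ (fun _ => norm_nonneg _) (hf₀ t))
      (hperturb h₁ (by have := h₀.1 1; linarith) _ (fun _ => norm_nonneg _) (hf₁ t')))
    rw [hφy, hφy] at this
    simpa [add_mul, Finset.sum_add_distrib, Finset.mul_sum] using this
  have hy0 : ∀ j, 0 ≤ y j := by
    intro j
    by_contra! hneg
    have hlow : ∀ s : ℝ, 0 ≤ s → φ ((1 - θ) • G 0 + θ • H 0 + (-s) • Pi.single j 1) < φ b := by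
      intro s hs
      have hle : ∀ i, ((-s) • (Pi.single j 1 : Fin n → ℝ)) i ≤ d := by
        intro i
        by_cases hij : i = j
        · subst hij; simp; linarith
        · simp [hij, hd.le]
      exact hφ _ (calLog_add
        ((h₀.exp_mono fun i => add_le_add_right (hle i) _).trans_lt
          (hperturb h₀ (by have := h₁.1 1; linarith) _ (fun _ => norm_nonneg _) (hf₀ 0)))
        ((h₁.exp_mono fun i => add_le_add_right (hle i) _).trans_lt
          (hperturb h₁ (by have := h₀.1 1; linarith) _ (fun _ => norm_nonneg _) (hf₁ 0))))
    have hy' : φ (Pi.single j 1) = y j := rfl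
    set p := φ ((1 - θ) • G 0 + θ • H 0) with hp
    have h := hlow (max 0 ((φ b - p) / (-y j))) (le_max_left _ _)
    rw [map_add, map_smul, hy', smul_eq_mul, ← hp] at h
    have h2 := le_max_right 0 ((φ b - p) / (-y j))
    rw [div_le_iff₀ (by linarith)] at h2
    nlinarith
  have hysum : 0 < ∑ j, y j := by
    refine lt_of_le_of_ne (Finset.sum_nonneg fun j _ => hy0 j) fun h0 => ?_
    have h0' := (Finset.sum_eq_zero_iff_of_nonneg fun j _ => hy0 j).1 h0.symm
    have := hGH 0 0
    rw [← h0, Finset.sum_eq_zero fun j hj => by rw [h0' j hj, mul_zero],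
      Finset.sum_eq_zero fun j hj => by rw [h0' j hj, mul_zero]] at this
    simp at this
  -- uniform upper bound of the boundary values
  choose B hB using hfb
  set R : ℝ := ∑ j, |Real.log (|B j| + δ)| with hR
  have hR0 : 0 ≤ R := Finset.sum_nonneg fun j _ => abs_nonneg _
  have hlogR : ∀ j, ∀ z ∈ Strip, Real.log (‖f j z‖ + δ) ≤ R := by
    intro j z hz
    have h1 : Real.log (‖f j z‖ + δ) ≤ Real.log (|B j| + δ) :=
      Real.log_le_log (by positivity)
        (by have := hB j z hz; have := le_abs_self (B j); linarith)
    exact h1.trans ((le_abs_self _).trans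
      (Finset.single_le_sum (f := fun j => |Real.log (|B j| + δ)|)
        (fun j _ => abs_nonneg _) (Finset.mem_univ j)))
  have hs0 : ∀ t : ℝ, Complex.I * t ∈ Strip := fun t => by simp [Strip]
  have hs1 : ∀ t : ℝ, 1 + Complex.I * t ∈ Strip := fun t => by simp [Strip]
  -- approximation of `y` by integer exponents
  obtain ⟨m, hm⟩ := exists_nat_gt ((n * R + ∑ j, |b j| + 1) / (d * ∑ j, y j))
  rw [div_lt_iff₀ (mul_pos hd hysum)] at hm
  set k : Fin n → ℕ := fun j => ⌈m * y j⌉₊ with hk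
  have hk0 : ∀ j, 0 ≤ (k j : ℝ) - m * y j := fun j => sub_nonneg.2 (Nat.le_ceil _)
  have hk1 : ∀ j, (k j : ℝ) - m * y j ≤ 1 := fun j => by
    have := Nat.ceil_lt_add_one (mul_nonneg (Nat.cast_nonneg m) (hy0 j))
    simp only [hk]; linarith
  have hkey : ∀ t t', (1 - θ) * ∑ j, k j * G t j + θ * ∑ j, k j * H t' j
      ≤ ∑ j, k j * b j - 1 := by
    intro t t'
    set γ : Fin n → ℝ := fun j => (1 - θ) * G t j + θ * H t' j with hγ
    have hγR : ∀ j, γ j ≤ R := by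
      intro j
      have h1 := hlogR j _ (hs0 t)
      have h2 := hlogR j _ (hs1 t')
      simp only [hγ, hG, hH]
      nlinarith
    have e1 : (1 - θ) * ∑ j, k j * G t j + θ * ∑ j, k j * H t' j = ∑ j, k j * γ j := by
      rw [Finset.mul_sum, Finset.mul_sum, ← Finset.sum_add_distrib]
      exact Finset.sum_congr rfl fun j _ => by simp only [hγ]; ring
    have e2 : ∑ j, (k j : ℝ) * γ j ≤ m * ∑ j, γ j * y j + n * R := by
      have : (n : ℝ) * R = ∑ _j : Fin n, R := by simp
      rw [this, Finset.mul_sum, ← Finset.sum_add_distrib]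
      refine Finset.sum_le_sum fun j _ => ?_
      nlinarith [mul_le_mul_of_nonneg_left (hγR j) (hk0 j), mul_le_mul_of_nonneg_right (hk1 j) hR0]
    have e3 : m * ∑ j, b j * y j - ∑ j, |b j| ≤ ∑ j, (k j : ℝ) * b j := by
      rw [Finset.mul_sum, ← Finset.sum_sub_distrib]
      refine Finset.sum_le_sum fun j _ => ?_
      have h1 := mul_le_mul_of_nonneg_left (neg_abs_le (b j)) (hk0 j)
      have h2 := mul_le_mul_of_nonneg_right (hk1 j) (abs_nonneg (b j))
      nlinarith
    have e4 : (m : ℝ) * (∑ j, γ j * y j + d * ∑ j, y j) ≤ m * ∑ j, b j * y j :=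
      mul_le_mul_of_nonneg_left (hGH t t').le (Nat.cast_nonneg m)
    rw [e1]
    nlinarith
  set S : ℝ := ∑ j, k j * b j - 1 with hS
  set A : ℝ := ⨆ t, ∑ j, k j * G t j with hA
  have hbdd : BddAbove (Set.range fun t => ∑ j, k j * G t j) := by
    refine ⟨∑ j, k j * R, ?_⟩
    rintro _ ⟨t, rfl⟩
    exact Finset.sum_le_sum fun j _ =>
      mul_le_mul_of_nonneg_left (hlogR j _ (hs0 t)) (Nat.cast_nonneg _)
  have hAle : ∀ t', ∑ j, k j * H t' j ≤ (S - (1 - θ) * A) / θ := by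
    intro t'
    have h1 : A ≤ (S - θ * ∑ j, k j * H t' j) / (1 - θ) := ciSup_le fun t => by
      rw [le_div_iff₀ (by linarith)]
      linarith [hkey t t']
    rw [le_div_iff₀ (by linarith)] at h1
    rw [le_div_iff₀ hθ]
    linarith
  set F : ℂ → ℂ := fun z => ∏ j, f j z ^ k j with hF
  have hFexp : ∀ z, ‖F z‖ ≤ Real.exp (∑ j, k j * Real.log (‖f j z‖ + δ)) := by
    intro z
    rw [Real.exp_sum, hF, norm_prod]
    refine Finset.prod_le_prod (fun j _ => norm_nonneg _) fun j _ => ?_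
    rw [Real.exp_nat_mul, Real.exp_log (by positivity), norm_pow]
    exact pow_le_pow_left₀ (norm_nonneg _) (by linarith) _
  have h3 := norm_le_exp_of_strip hθ hθ1 (F := F) (A := A) (B := (S - (1 - θ) * A) / θ)
    (continuousOn_finsetProd _ fun j _ => (hfc j).pow _)
    (DifferentiableOn.fun_finsetProd fun j _ => (hfd j).pow _)
    ⟨Real.exp (∑ j, k j * R), fun z hz => (hFexp z).trans (Real.exp_le_exp.2
      (Finset.sum_le_sum fun j _ =>
        mul_le_mul_of_nonneg_left (hlogR j z hz) (Nat.cast_nonneg _)))⟩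
    (fun t => (hFexp _).trans (Real.exp_le_exp.2 (le_ciSup hbdd t)))
    (fun t => (hFexp _).trans (Real.exp_le_exp.2 (hAle t)))
  have h4 : ‖F (θ : ℂ)‖ = Real.exp (∑ j, k j * b j) := by
    rw [Real.exp_sum, hF, norm_prod]
    refine Finset.prod_congr rfl fun j _ => ?_
    rw [Real.exp_nat_mul, Real.exp_log (norm_pos_iff.2 (hpos j)), norm_pow]
  rw [h4, Real.exp_le_exp, mul_div_cancel₀ _ hθ.ne'] at h3
  linarith

/-- Every norm function on a complex vector space admits norming functionals. -/
lemma IsNormC.exists_norming {V : Type*} [AddCommGroup V] [Module ℂ V] {N : V → ℝ}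
    (hN : IsNormC N) (v : V) :
    ∃ ψ : V →ₗ[ℂ] ℂ, (∀ w, ‖ψ w‖ ≤ N w) ∧ ψ v = (N v : ℂ) := by
  let _ : Norm V := ⟨N⟩
  have core : NormedSpace.Core ℂ V :=
    { norm_nonneg := hN.1
      norm_smul := hN.2.2.1
      norm_triangle := hN.2.2.2
      norm_eq_zero_iff := fun x => ⟨hN.2.1 x, fun hx => by
        have h := hN.2.2.1 0 x
        simp only [zero_smul, norm_zero, zero_mul] at h
        rw [hx]; exact h⟩ }
  let _ : NormedAddCommGroup V := NormedAddCommGroup.ofCore core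
  let _ : NormedSpace ℂ V := NormedSpace.ofCore core
  obtain ⟨g, hg, hgv⟩ := exists_dual_vector'' ℂ v
  refine ⟨g.toLinearMap, fun w => ?_, hgv⟩
  calc ‖g w‖ ≤ ‖g‖ * ‖w‖ := g.le_opNorm w
    _ ≤ 1 * ‖w‖ := by gcongr
    _ = N w := one_mul _

lemma IsNormC.map_sum_le {V : Type*} [AddCommGroup V] [Module ℂ V] {N : V → ℝ}
    (hN : IsNormC N) {ι : Type*} (s : Finset ι) (v : ι → V) :
    N (∑ i ∈ s, v i) ≤ ∑ i ∈ s, N (v i) := by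
  have h0 : N 0 = 0 := by simpa using hN.2.2.1 0 0
  exact Finset.le_sum_of_subadditive N h0.le hN.2.2.2 s v

lemma IsNormC.exists_le_mul_norm {k : ℕ} {N : (Fin k → ℂ) → ℝ} (hN : IsNormC N) :
    ∃ A, 0 ≤ A ∧ ∀ v, N v ≤ A * ‖v‖ := by
  refine ⟨∑ i, N (Pi.single i 1), Finset.sum_nonneg fun i _ => hN.1 _, fun v => ?_⟩
  calc N v = N (∑ i, v i • Pi.single i (1 : ℂ)) := by
        congr 1
        conv_lhs => rw [pi_eq_sum_univ' v]
    _ ≤ ∑ i, N (v i • Pi.single i (1 : ℂ)) := hN.map_sum_le _ _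
    _ ≤ ∑ i, N (Pi.single i 1) * ‖v‖ := by
        refine Finset.sum_le_sum fun i _ => ?_
        rw [hN.2.2.1, mul_comm]
        exact mul_le_mul_of_nonneg_left (norm_le_pi_norm v i) (hN.1 _)
    _ = _ := by rw [Finset.sum_mul]

/-- `x` is the value at `θ` of an analytic function of finite type on the strip whose boundary
values have norm at most `c`. -/
def AnalyticBound {D : Type*} [AddCommGroup D] [Module ℂ D]
    (θ : ℝ) (N₀ N₁ : D → ℝ) (x : D) (c : ℝ) : Prop :=
  ∃ (m : ℕ) (φ : Fin m → ℂ → ℂ) (v : Fin m → D),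
    (∀ i, ContinuousOn (φ i) Strip) ∧
    (∀ i, DifferentiableOn ℂ (φ i) OStrip) ∧
    (∀ i, ∃ B : ℝ, ∀ z ∈ Strip, ‖φ i z‖ ≤ B) ∧
    (∑ i, φ i (θ : ℂ) • v i) = x ∧
    (∀ t : ℝ, N₀ (∑ i, φ i (Complex.I * t) • v i) ≤ c) ∧
    (∀ t : ℝ, N₁ (∑ i, φ i (1 + Complex.I * t) • v i) ≤ c)

lemma interpN_le_of_analyticBound {D : Type*} [AddCommGroup D] [Module ℂ D] {θ : ℝ}
    {N₀ N₁ : D → ℝ} (h₀ : ∀ x, 0 ≤ N₀ x) {x : D} {c : ℝ} (h : AnalyticBound θ N₀ N₁ x c) :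
    interpN θ N₀ N₁ x ≤ c :=
  csInf_le ⟨0, fun _ ⟨_, _, _, _, _, _, _, hc, _⟩ => (h₀ _).trans (hc 0)⟩ h

lemma analyticBound_max {D : Type*} [AddCommGroup D] [Module ℂ D] (θ : ℝ) (N₀ N₁ : D → ℝ) (x : D) :
    AnalyticBound θ N₀ N₁ x (max (N₀ x) (N₁ x)) :=
  ⟨1, fun _ _ => 1, fun _ => x, fun _ => continuousOn_const, fun _ => differentiableOn_const _,
    fun _ => ⟨1, fun _ _ => by simp⟩, by simp, fun _ => by simp, fun _ => by simp⟩

lemma exists_analyticBound_of_interpN_lt {D : Type*} [AddCommGroup D] [Module ℂ D] {θ : ℝ}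
    {N₀ N₁ : D → ℝ} {x : D} {c : ℝ} (h : interpN θ N₀ N₁ x < c) : AnalyticBound θ N₀ N₁ x c := by
  have hne : {d | AnalyticBound θ N₀ N₁ x d}.Nonempty := ⟨_, analyticBound_max θ N₀ N₁ x⟩
  obtain ⟨d, ⟨m, φ, v, h1, h2, h3, h4, h5, h6⟩, hdc⟩ := exists_lt_of_csInf_lt hne h
  exact ⟨m, φ, v, h1, h2, h3, h4, fun t => (h5 t).trans hdc.le, fun t => (h6 t).trans hdc.le⟩

lemma AnalyticBound.smul {D : Type*} [AddCommGroup D] [Module ℂ D] {θ : ℝ}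
    {N₀ N₁ : D → ℝ} {x : D} {c : ℝ} (h : AnalyticBound θ N₀ N₁ x c) {ρ : ℝ} (hρ : 0 ≤ ρ)
    (h₀ : ∀ y, N₀ ((ρ : ℂ) • y) = ρ * N₀ y) (h₁ : ∀ y, N₁ ((ρ : ℂ) • y) = ρ * N₁ y) :
    AnalyticBound θ N₀ N₁ ((ρ : ℂ) • x) (ρ * c) := by
  obtain ⟨m, φ, v, h1, h2, h3, h4, h5, h6⟩ := h
  have key : ∀ z, ∑ i, φ i z • (ρ : ℂ) • v i = (ρ : ℂ) • ∑ i, φ i z • v i := fun z => by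
    rw [Finset.smul_sum]
    exact Finset.sum_congr rfl fun i _ => smul_comm _ _ _
  refine ⟨m, φ, fun i => (ρ : ℂ) • v i, h1, h2, h3, by rw [key, h4], fun t => ?_, fun t => ?_⟩
  · rw [key, h₀]; exact mul_le_mul_of_nonneg_left (h5 t) hρ
  · rw [key, h₁]; exact mul_le_mul_of_nonneg_left (h6 t) hρ

lemma vecLatNorm_nonneg {n : ℕ} {V : Type*} {N : (Fin n → ℝ) → ℝ} (hN : IsLatticeNorm N)
    (NE : V → ℝ) (x : Fin n → V) : 0 ≤ vecLatNorm N NE x := hN.1 _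

lemma vecLatNorm_smul {n : ℕ} {V : Type*} [AddCommGroup V] [Module ℂ V] {N : (Fin n → ℝ) → ℝ}
    (hN : IsLatticeNorm N) {NE : V → ℝ} (hE : IsNormC NE) {ρ : ℝ} (hρ : 0 ≤ ρ) (x : Fin n → V) :
    vecLatNorm N NE ((ρ : ℂ) • x) = ρ * vecLatNorm N NE x := by
  unfold vecLatNorm
  rw [← hN.map_smul_of_nonneg hρ]
  congr 1
  ext j
  rw [Pi.smul_apply, hE.2.2.1, Complex.norm_real, Real.norm_of_nonneg hρ]

lemma vecLatNorm_exists_le_mul_norm {n k : ℕ} {N : (Fin n → ℝ) → ℝ} (hN : IsLatticeNorm N)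
    {NE : (Fin k → ℂ) → ℝ} (hE : IsNormC NE) :
    ∃ A, 0 ≤ A ∧ ∀ x : Fin n → Fin k → ℂ, vecLatNorm N NE x ≤ A * ‖x‖ := by
  obtain ⟨A, hA, h⟩ := hE.exists_le_mul_norm
  refine ⟨A * N 1, mul_nonneg hA (hN.1 _), fun x => ?_⟩
  calc vecLatNorm N NE x ≤ N (fun j => (A * ‖x‖) * (1 : Fin n → ℝ) j) := by
        refine hN.mono_of_nonneg (fun j => hE.1 _) fun j => ?_
        rw [Pi.one_apply, mul_one]
        exact (h _).trans (mul_le_mul_of_nonneg_left (norm_le_pi_norm x j) hA)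
    _ = A * N 1 * ‖x‖ := by rw [hN.map_smul_of_nonneg (by positivity)]; ring

/-- An operator in the unit ball of `L(ℓ₂, [X₀(E), X₁(E)]_θ)` sends the open ball of radius `ρ`
to values at `θ` of analytic functions bounded by `ρ` on the boundary of the strip. -/
lemma analyticBound_of_opN_le_one {n k : ℕ} {θ : ℝ} {N₀ N₁ : (Fin n → ℝ) → ℝ}
    (h₀ : IsLatticeNorm N₀) (h₁ : IsLatticeNorm N₁) {NE : (Fin k → ℂ) → ℝ} (hE : IsNormC NE)
    (T : Hilb →L[ℂ] (Fin n → Fin k → ℂ))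
    (hT : opN hilbNorm (interpN θ (vecLatNorm N₀ NE) (vecLatNorm N₁ NE)) ⇑T ≤ 1)
    {x : Hilb} {ρ : ℝ} (hx : ‖x‖ < ρ) :
    AnalyticBound θ (vecLatNorm N₀ NE) (vecLatNorm N₁ NE) (T x) ρ := by
  obtain ⟨A₀, hA₀, hN₀⟩ := vecLatNorm_exists_le_mul_norm h₀ hE
  obtain ⟨A₁, hA₁, hN₁⟩ := vecLatNorm_exists_le_mul_norm h₁ hE
  have hball : ∀ y : Hilb, ‖y‖ ≤ 1 →
      interpN θ (vecLatNorm N₀ NE) (vecLatNorm N₁ NE) (T y) ≤ 1 := fun y hy => by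
    suffices hbdd : BddAbove {r : ℝ | ∃ x, hilbNorm x ≤ 1 ∧
        r = interpN θ (vecLatNorm N₀ NE) (vecLatNorm N₁ NE) (T x)} from
      le_trans (le_csSup hbdd ⟨y, hy, rfl⟩) hT
    refine ⟨(A₀ + A₁) * ‖T‖, ?_⟩
    rintro _ ⟨z, hz, rfl⟩
    have hTz : ‖T z‖ ≤ ‖T‖ := by
      simpa using T.le_opNorm_of_le (c := 1) hz
    refine (interpN_le_of_analyticBound (vecLatNorm_nonneg h₀ NE)
      (analyticBound_max _ _ _ _)).trans (max_le ?_ ?_)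
    · refine (hN₀ _).trans ?_
      gcongr
      linarith
    · refine (hN₁ _).trans ?_
      gcongr
      linarith
  have hρ : 0 < ρ := (norm_nonneg x).trans_lt hx
  obtain ⟨r, hxr, hrρ⟩ := exists_between hx
  have hr : 0 < r := (norm_nonneg x).trans_lt hxr
  have hle := hball ((r⁻¹ : ℂ) • x) (by
    rw [norm_smul, norm_inv, Complex.norm_real, Real.norm_of_nonneg hr.le, inv_mul_le_one₀ hr]
    exact hxr.le)
  have hb := (exists_analyticBound_of_interpN_lt
    (hle.trans_lt ((one_lt_div hr).2 hrρ))).smul hr.le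
      (vecLatNorm_smul h₀ hE hr.le) (vecLatNorm_smul h₁ hE hr.le)
  have hr' : (r : ℂ) ≠ 0 := by exact_mod_cast hr.ne'
  rwa [map_smul, smul_smul, mul_inv_cancel₀ hr', one_smul, mul_div_cancel₀ _ hr.ne'] at hb

/-- Composing with norming functionals turns vector valued analytic functions into scalar ones. -/
lemma AnalyticBound.exists_scalar {n : ℕ} {V : Type*} [AddCommGroup V] [Module ℂ V] {θ : ℝ}
    {N₀ N₁ : (Fin n → ℝ) → ℝ} (h₀ : IsLatticeNorm N₀) (h₁ : IsLatticeNorm N₁) {NE : V → ℝ}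
    (hE : IsNormC NE) {y : Fin n → V} {c : ℝ}
    (h : AnalyticBound θ (vecLatNorm N₀ NE) (vecLatNorm N₁ NE) y c) :
    ∃ f : Fin n → ℂ → ℂ, (∀ j, ContinuousOn (f j) Strip) ∧
      (∀ j, DifferentiableOn ℂ (f j) OStrip) ∧ (∀ j, ∃ B, ∀ z ∈ Strip, ‖f j z‖ ≤ B) ∧
      (∀ j, f j (θ : ℂ) = (NE (y j) : ℂ)) ∧
      (∀ t : ℝ, N₀ (fun j => ‖f j (Complex.I * t)‖) ≤ c) ∧
      (∀ t : ℝ, N₁ (fun j => ‖f j (1 + Complex.I * t)‖) ≤ c) := by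
  obtain ⟨m, φ, v, h1, h2, h3, h4, h5, h6⟩ := h
  choose ψ hψ hψy using fun j => hE.exists_norming (y j)
  have key : ∀ j z, ∑ i, φ i z * ψ j (v i j) = ψ j ((∑ i, φ i z • v i) j) := fun j z => by
    simp [Finset.sum_apply, map_sum]
  refine ⟨fun j z => ∑ i, φ i z * ψ j (v i j),
    fun j => continuousOn_finsetSum _ fun i _ => (h1 i).mul continuousOn_const,
    fun j => DifferentiableOn.fun_sum fun i _ => (h2 i).mul (differentiableOn_const _),
    fun j => ?_, fun j => (key j θ).trans (by rw [h4, hψy]), fun t => ?_, fun t => ?_⟩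
  · choose B hB using h3
    refine ⟨∑ i, B i * ‖ψ j (v i j)‖, fun z hz => (norm_sum_le _ _).trans
      (Finset.sum_le_sum fun i _ => ?_)⟩
    rw [norm_mul]
    exact mul_le_mul_of_nonneg_right (hB i z hz) (norm_nonneg _)
  · refine (h₀.mono_of_nonneg (fun j => norm_nonneg _) fun j => ?_).trans (h5 t)
    simp only [key]
    exact hψ j _
  · refine (h₁.mono_of_nonneg (fun j => norm_nonneg _) fun j => ?_).trans (h6 t)
    simp only [key]
    exact hψ j _

/-- The set of logarithms of squared multipliers from `ℓ₂ⁿ` into the lattice with norm `N`. -/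
def multLog {n : ℕ} (N : (Fin n → ℝ) → ℝ) : Set (Fin n → ℝ) :=
  {s | ∀ f : Fin n → ℝ, N (fun j => Real.exp (s j / 2) * f j) ^ 2 ≤ ∑ j, f j ^ 2}

lemma convex_multLog {n : ℕ} {N : (Fin n → ℝ) → ℝ} (hN : IsLatticeNorm N) :
    Convex ℝ (multLog N) := by
  intro s hs t ht a b ha hb hab
  show ∀ f : Fin n → ℝ, _
  intro f
  have habs : ∀ {u : Fin n → ℝ}, u ∈ multLog N →
      N (fun j => Real.exp (u j / 2) * |f j|) ≤ Real.sqrt (∑ j, f j ^ 2) := fun {u} hu => by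
    refine Real.le_sqrt_of_sq_le ?_
    have h := (show ∀ f : Fin n → ℝ, _ from hu) fun j => |f j|
    simpa using h
  rw [← Real.sq_sqrt (Finset.sum_nonneg fun j _ => sq_nonneg (f j))]
  refine pow_le_pow_left₀ (hN.1 _) ?_ 2
  calc N (fun j => Real.exp ((a • s + b • t) j / 2) * f j)
      ≤ N ((fun j => a * (Real.exp (s j / 2) * |f j|)) +
          fun j => b * (Real.exp (t j / 2) * |f j|)) := by
        refine hN.2.2.2.2 _ _ fun j => ?_
        have hconv := convexOn_exp.2 (Set.mem_univ (s j / 2)) (Set.mem_univ (t j / 2)) ha hb hab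
        simp only [smul_eq_mul] at hconv
        have hpos : 0 ≤ a * (Real.exp (s j / 2) * |f j|) + b * (Real.exp (t j / 2) * |f j|) := by
          positivity
        simp only [Pi.add_apply, Pi.smul_apply, smul_eq_mul]
        rw [abs_of_nonneg hpos, abs_mul, Real.abs_exp,
          show (a * s j + b * t j) / 2 = a * (s j / 2) + b * (t j / 2) by ring]
        calc _ ≤ (a * Real.exp (s j / 2) + b * Real.exp (t j / 2)) * |f j| := by gcongr
          _ = _ := by ring
    _ ≤ a * Real.sqrt (∑ j, f j ^ 2) + b * Real.sqrt (∑ j, f j ^ 2) := by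
        refine (hN.2.2.2.1 _ _).trans ?_
        rw [hN.map_smul_of_nonneg ha, hN.map_smul_of_nonneg hb]
        exact add_le_add (mul_le_mul_of_nonneg_left (habs hs) ha)
          (mul_le_mul_of_nonneg_left (habs ht) hb)
    _ = _ := by rw [← add_mul, hab, one_mul]

/-- Boundary estimate for the analytic family interpolating an operator through `ℓ₂ⁿ(E)`. -/
lemma opN_le_of_multLog {n k : ℕ} {N : (Fin n → ℝ) → ℝ}
    {NE : (Fin k → ℂ) → ℝ} (hE : IsNormC NE) {T S : Hilb →L[ℂ] (Fin n → Fin k → ℂ)}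
    {s σ : Fin n → ℝ} (hs : s ∈ multLog N) {a : Fin n → ℂ}
    (ha : ∀ j, ‖a j‖ = Real.exp ((s j - σ j) / 2)) (hS : ∀ x j, S x j = a j • T x j)
    {K : ℝ} (hK : 0 ≤ K)
    (hT : ∀ x, ∑ j, NE (T x j) ^ 2 * Real.exp (-σ j) ≤ K ^ 2 * ‖x‖ ^ 2) :
    opN hilbNorm (vecLatNorm N NE) ⇑S ≤ K := by
  refine Real.sSup_le ?_ hK
  rintro _ ⟨x, hx, rfl⟩
  refine le_of_sq_le_sq ?_ hK
  calc vecLatNorm N NE (S x) ^ 2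
      = N (fun j => Real.exp (s j / 2) * (NE (T x j) * Real.exp (-σ j / 2))) ^ 2 := by
        unfold vecLatNorm
        congr 2
        ext j
        rw [hS, hE.2.2.1, ha, sub_div, sub_eq_add_neg, Real.exp_add, neg_div]
        ring
    _ ≤ ∑ j, NE (T x j) ^ 2 * Real.exp (-σ j) := by
        refine (show ∀ f : Fin n → ℝ, _ from hs) _ |>.trans_eq (Finset.sum_congr rfl fun j _ => ?_)
        rw [mul_pow, ← Real.exp_nat_mul]
        congr 2
        push_cast
        ring
    _ ≤ K ^ 2 * ‖x‖ ^ 2 := hT x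
    _ ≤ K ^ 2 * 1 := by
        gcongr
        exact pow_le_one₀ (norm_nonneg x) hx
    _ = K ^ 2 := mul_one _

lemma interpN_opN_le {n k : ℕ} {θ : ℝ} {N₀ N₁ : (Fin n → ℝ) → ℝ}
    (h₀ : IsLatticeNorm N₀) {NE : (Fin k → ℂ) → ℝ} (hE : IsNormC NE)
    (T : Hilb →L[ℂ] (Fin n → Fin k → ℂ)) {s₀ s₁ : Fin n → ℝ}
    (hs₀ : s₀ ∈ multLog N₀) (hs₁ : s₁ ∈ multLog N₁) {K : ℝ} (hK : 0 ≤ K)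
    (hT : ∀ x, ∑ j, NE (T x j) ^ 2 * Real.exp (-((1 - θ) * s₀ j + θ * s₁ j)) ≤ K ^ 2 * ‖x‖ ^ 2) :
    interpN θ (fun S : Hilb →L[ℂ] (Fin n → Fin k → ℂ) => opN hilbNorm (vecLatNorm N₀ NE) ⇑S)
      (fun S => opN hilbNorm (vecLatNorm N₁ NE) ⇑S) T ≤ K := by
  set σ : Fin n → ℝ := fun j => (1 - θ) * s₀ j + θ * s₁ j with hσ
  set φ : Fin n → ℂ → ℂ := fun j z =>
    Complex.exp (((1 - z) * (s₀ j : ℂ) + z * (s₁ j : ℂ) - (σ j : ℂ)) / 2) with hφ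
  have hdiff : ∀ j, Differentiable ℂ (φ j) := fun j => by fun_prop
  have hnorm : ∀ j z, ‖φ j z‖ = Real.exp (((1 - z.re) * s₀ j + z.re * s₁ j - σ j) / 2) := by
    intro j z
    rw [hφ]
    simp [Complex.norm_exp]
  have hS : ∀ (z : ℂ) (x : Hilb) (j : Fin n),
      (∑ i, φ i z • ((ContinuousLinearMap.single ℂ (fun _ => Fin k → ℂ) i).comp
        ((ContinuousLinearMap.proj i).comp T))) x j = φ j z • T x j := by
    intro z x j
    rw [_root_.sum_apply, Finset.sum_apply, Finset.sum_eq_single j]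
    · simp
    · intro i _ hij
      simp [Pi.single_eq_of_ne hij.symm]
    · simp
  have hnn : ∀ S : Hilb →L[ℂ] (Fin n → Fin k → ℂ), 0 ≤ opN hilbNorm (vecLatNorm N₀ NE) ⇑S := by
    intro S
    refine Real.sSup_nonneg ?_
    rintro _ ⟨x, _, rfl⟩
    exact vecLatNorm_nonneg h₀ NE _
  refine interpN_le_of_analyticBound hnn
    ⟨n, φ, fun j => (ContinuousLinearMap.single ℂ (fun _ => Fin k → ℂ) j).comp
      ((ContinuousLinearMap.proj j).comp T), fun j => (hdiff j).continuous.continuousOn,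
      fun j => (hdiff j).differentiableOn, fun j => ?_, ?_, fun t => ?_, fun t => ?_⟩
  · refine ⟨Real.exp ((|s₀ j| + |s₁ j| - σ j) / 2), fun z hz => ?_⟩
    rw [hnorm]
    obtain ⟨hz0, hz1⟩ := hz
    gcongr
    · calc (1 - z.re) * s₀ j ≤ (1 - z.re) * |s₀ j| :=
            mul_le_mul_of_nonneg_left (le_abs_self _) (by linarith)
        _ ≤ |s₀ j| := mul_le_of_le_one_left (abs_nonneg _) (by linarith)
    · calc z.re * s₁ j ≤ z.re * |s₁ j| := mul_le_mul_of_nonneg_left (le_abs_self _) hz0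
        _ ≤ |s₁ j| := mul_le_of_le_one_left (abs_nonneg _) hz1
  · ext1 x
    funext j
    rw [hS]
    have h1 : φ j θ = 1 := by
      rw [hφ]
      simp [hσ]
    rw [h1, one_smul]
  · exact opN_le_of_multLog hE hs₀ (fun j => by rw [hnorm]; simp [hσ]) (hS _) hK hT
  · exact opN_le_of_multLog hE hs₁ (fun j => by rw [hnorm]; simp [hσ]) (hS _) hK hT

lemma sum_signs_norm_sq {H : Type*} [NormedAddCommGroup H] [InnerProductSpace ℂ H] :
    ∀ {m : ℕ} (y : H) (x : Fin m → H),
      ∑ ε : Fin m → Bool, ‖y + ∑ i, if ε i then x i else -x i‖ ^ 2 =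
        2 ^ m * (‖y‖ ^ 2 + ∑ i, ‖x i‖ ^ 2)
  | 0, y, x => by simp
  | m + 1, y, x => by
    have ih := fun z => sum_signs_norm_sq z (fun i => x (Fin.succ i))
    have hp := parallelogram_law_with_norm ℂ y (x 0)
    rw [← (Fin.consEquiv fun _ : Fin (m + 1) => Bool).sum_comp, Fintype.sum_prod_type]
    simp only [Fintype.sum_bool, Fin.consEquiv_apply, Fin.sum_univ_succ, Fin.cons_zero,
      Fin.cons_succ, ← add_assoc, if_true, Bool.false_eq_true, if_false]
    rw [ih, ih, ← sub_eq_add_neg]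
    linear_combination (2 : ℝ) ^ m * hp

/-- A Rademacher sum of vectors with `∑ ‖xᵢ‖² ≤ 1` has mean norm at most one. -/
lemma mean_norm_signs_le_one {H : Type*} [NormedAddCommGroup H] [InnerProductSpace ℂ H]
    {m : ℕ} {x : Fin m → H} (hx : ∑ i, ‖x i‖ ^ 2 ≤ 1) :
    ((2 : ℝ) ^ m)⁻¹ * ∑ ε : Fin m → Bool, ‖∑ i, if ε i then x i else -x i‖ ≤ 1 := by
  have h2 : (0 : ℝ) < 2 ^ m := by positivity
  have h := sum_signs_norm_sq 0 x
  simp only [zero_add, norm_zero, ne_eq, OfNat.ofNat_ne_zero, not_false_eq_true, zero_pow] at h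
  have hle : ∑ ε : Fin m → Bool, ‖∑ i, if ε i then x i else -x i‖ ≤
      ∑ ε : Fin m → Bool, (1 + ‖∑ i, if ε i then x i else -x i‖ ^ 2) / 2 :=
    Finset.sum_le_sum fun ε _ => by
      nlinarith [sq_nonneg (‖∑ i, if ε i then x i else -x i‖ - 1)]
  rw [← Finset.sum_div, Finset.sum_add_distrib, h] at hle
  simp only [Finset.sum_const, Finset.card_univ, Fintype.card_fun, Fintype.card_bool,
    Fintype.card_fin, nsmul_eq_mul, mul_one] at hle
  push_cast at hle
  rw [inv_mul_le_one₀ h2]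
  nlinarith

/-- Cotype 2 with the `L¹` Rademacher average, using the Kahane inequality with constant `√2`. -/
lemma Cotype2With.sqrt_sum_sq_le {V : Type*} [AddCommGroup V] [Module ℂ V] {N : V → ℝ} {C : ℝ}
    (h : Cotype2With N C) (hN : IsNormC N) (hC : 0 ≤ C) {m : ℕ} (y : Fin m → V) :
    Real.sqrt (∑ i, N (y i) ^ 2) ≤ Real.sqrt 2 * C *
      (((2 : ℝ) ^ m)⁻¹ * ∑ ε : Fin m → Bool, N (∑ i, if ε i then y i else -y i)) := by
  have h2 : (0 : ℝ) < 2 ^ m := by positivity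
  set S := ∑ ε : Fin m → Bool, N (∑ i, if ε i then y i else -y i) with hS
  have hS0 : 0 ≤ S := Finset.sum_nonneg fun ε _ => hN.1 _
  have hk := sum_sq_le_two_mul_sq_sum hN y
  have hrad : radAvg N y ≤ 2 * (((2 : ℝ) ^ m)⁻¹ * S) ^ 2 := by
    unfold radAvg
    rw [mul_pow, inv_pow, inv_mul_le_iff₀ h2]
    calc _ = ((2 : ℝ) ^ m)⁻¹ *
          (2 ^ m * ∑ ε : Fin m → Bool, N (∑ i, if ε i then y i else -y i) ^ 2) := by
          field_simp
      _ ≤ ((2 : ℝ) ^ m)⁻¹ * (2 * S ^ 2) := by gcongr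
      _ = _ := by field_simp
  calc _ ≤ C * Real.sqrt (radAvg N y) := h m y
    _ ≤ C * Real.sqrt (2 * (((2 : ℝ) ^ m)⁻¹ * S) ^ 2) := by gcongr
    _ = _ := by
      rw [Real.sqrt_mul zero_le_two, Real.sqrt_sq (by positivity)]
      ring

lemma IsLatticeNorm.mean_add_const_le {n : ℕ} {N : (Fin n → ℝ) → ℝ} (hN : IsLatticeNorm N)
    {m : ℕ} {F : Fin n → ℂ} {a : (Fin m → Bool) → Fin n → ℂ} {r : (Fin m → Bool) → ℝ} {η : ℝ}
    (hη : 0 ≤ η) (hF : ∀ j, F j = (((2 : ℝ) ^ m)⁻¹ : ℝ) * ∑ ε, a ε j + (η : ℂ))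
    (ha : ∀ ε, N (fun j => ‖a ε j‖) ≤ r ε) :
    N (fun j => ‖F j‖) ≤ ((2 : ℝ) ^ m)⁻¹ * ∑ ε, r ε + η * N 1 := by
  have hsum : N (∑ ε, fun j => ‖a ε j‖) ≤ ∑ ε, N (fun j => ‖a ε j‖) :=
    Finset.le_sum_of_subadditive N hN.map_zero.le hN.2.2.2.1 _ _
  calc N (fun j => ‖F j‖)
      ≤ N ((fun j => ((2 : ℝ) ^ m)⁻¹ * (∑ ε, fun j => ‖a ε j‖) j) +
          fun j => η * (1 : Fin n → ℝ) j) := by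
        refine hN.mono_of_nonneg (fun j => norm_nonneg _) fun j => ?_
        rw [hF, Pi.add_apply, Finset.sum_apply, Pi.one_apply, mul_one]
        refine (norm_add_le _ _).trans ?_
        rw [norm_mul, Complex.norm_real, Complex.norm_real, Real.norm_of_nonneg hη,
          Real.norm_of_nonneg (by positivity)]
        gcongr
        exact norm_sum_le _ _
    _ ≤ _ := by
        refine (hN.2.2.2.1 _ _).trans ?_
        rw [hN.map_smul_of_nonneg (by positivity), hN.map_smul_of_nonneg hη]
        gcongr
        exact hsum.trans (Finset.sum_le_sum fun ε _ => ha ε)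

/-- Rademacher averages of an operator in the unit ball of `L(ℓ₂, [X₀(E), X₁(E)]_θ)` factor
through the Calderón product. -/
lemma log_mean_mem_calLog {n k : ℕ} {θ : ℝ} (hθ : 0 < θ) (hθ1 : θ < 1)
    {N₀ N₁ : (Fin n → ℝ) → ℝ} (h₀ : IsLatticeNorm N₀) (h₁ : IsLatticeNorm N₁)
    {NE : (Fin k → ℂ) → ℝ} (hE : IsNormC NE) {T : Hilb →L[ℂ] (Fin n → Fin k → ℂ)}
    (hT : ∀ (x : Hilb) (ρ : ℝ), ‖x‖ < ρ →
      AnalyticBound θ (vecLatNorm N₀ NE) (vecLatNorm N₁ NE) (T x) ρ)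
    {m : ℕ} {x : Fin m → Hilb} (hx : ∑ i, ‖x i‖ ^ 2 ≤ 1) {η κ : ℝ} (hη : 0 < η)
    (hκ : 1 + η + η * (N₀ 1 + N₁ 1) < κ) :
    (fun j => Real.log (((2 : ℝ) ^ m)⁻¹ *
      ∑ ε : Fin m → Bool, NE (∑ i, if ε i then T (x i) j else -T (x i) j) + η)) ∈
        calLog θ κ N₀ N₁ := by
  set X : (Fin m → Bool) → Hilb := fun ε => ∑ i, if ε i then x i else -x i with hX
  have hTX : ∀ ε j, T (X ε) j = ∑ i, if ε i then T (x i) j else -T (x i) j := by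
    intro ε j
    rw [hX, map_sum, Finset.sum_apply]
    refine Finset.sum_congr rfl fun i _ => ?_
    split_ifs <;> simp
  choose f hfc hfd hfb hfθ hf₀ hf₁ using fun ε =>
    (hT (X ε) (‖X ε‖ + η) (lt_add_of_pos_right _ hη)).exists_scalar h₀ h₁ hE
  have hmean : ((2 : ℝ) ^ m)⁻¹ * ∑ ε, (‖X ε‖ + η) ≤ 1 + η := by
    have h := mean_norm_signs_le_one hx
    rw [Finset.sum_add_distrib, mul_add]
    refine add_le_add h (le_of_eq ?_)
    simp
  have hbd : ∀ {N : (Fin n → ℝ) → ℝ}, N 1 ≤ N₀ 1 + N₁ 1 →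
      ((2 : ℝ) ^ m)⁻¹ * ∑ ε, (‖X ε‖ + η) + η * N 1 ≤ 1 + η + η * (N₀ 1 + N₁ 1) := fun h => by
    gcongr
  set F : Fin n → ℂ → ℂ := fun j z => (((2 : ℝ) ^ m)⁻¹ : ℝ) * ∑ ε, f ε j z + (η : ℂ) with hF
  have hmean0 : ∀ j, 0 ≤ ((2 : ℝ) ^ m)⁻¹ *
      ∑ ε : Fin m → Bool, NE (∑ i, if ε i then T (x i) j else -T (x i) j) := fun j =>
    mul_nonneg (by positivity) (Finset.sum_nonneg fun ε _ => hE.1 _)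
  have hFθ : ∀ j, F j θ = ((((2 : ℝ) ^ m)⁻¹ *
      ∑ ε : Fin m → Bool, NE (∑ i, if ε i then T (x i) j else -T (x i) j) + η : ℝ) : ℂ) := by
    intro j
    simp only [hF, hfθ, hTX]
    push_cast
    rfl
  have hnorm : ∀ j, ‖F j θ‖ = ((2 : ℝ) ^ m)⁻¹ *
      ∑ ε : Fin m → Bool, NE (∑ i, if ε i then T (x i) j else -T (x i) j) + η := fun j => by
    rw [hFθ, Complex.norm_real, Real.norm_of_nonneg (by linarith [hmean0 j])]
  simp only [← hnorm]
  have hN₀ := h₀.1 1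
  have hN₁ := h₁.1 1
  refine log_norm_mem_calLog hθ hθ1 h₀ h₁ (fun j => ?_) (fun j => ?_) (fun j => ?_)
    (c := 1 + η + η * (N₀ 1 + N₁ 1)) (by positivity) hκ (fun t => ?_) (fun t => ?_) fun j => ?_
  · exact (continuousOn_const.mul (continuousOn_finsetSum _ fun ε _ => hfc ε j)).add
      continuousOn_const
  · exact ((differentiableOn_const _).mul (DifferentiableOn.fun_sum fun ε _ => hfd ε j)).add
      (differentiableOn_const _)
  · choose B hB using fun ε => hfb ε j
    refine ⟨‖((((2 : ℝ) ^ m)⁻¹ : ℝ) : ℂ)‖ * ∑ ε, B ε + ‖(η : ℂ)‖, fun z hz => ?_⟩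
    refine (norm_add_le _ _).trans ?_
    rw [norm_mul]
    gcongr
    exact (norm_sum_le _ _).trans (Finset.sum_le_sum fun ε _ => hB ε z hz)
  · exact (h₀.mean_add_const_le hη.le (fun j => rfl) fun ε => hf₀ ε t).trans (hbd (by linarith))
  · exact (h₁.mean_add_const_le hη.le (fun j => rfl) fun ε => hf₁ ε t).trans (hbd (by linarith))
  · rw [← norm_pos_iff, hnorm]
    linarith [hmean0 j]

lemma sum_rpow_mul_rpow_le {n : ℕ} {θ : ℝ} (hθ : 0 < θ) (hθ1 : θ < 1) {u v : Fin n → ℝ}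
    (hu : ∀ j, 0 ≤ u j) (hv : ∀ j, 0 ≤ v j) {A B : ℝ} (hA : 0 < A) (hB : 0 < B)
    (huA : ∑ j, u j ≤ A) (hvB : ∑ j, v j ≤ B) :
    ∑ j, u j ^ (1 - θ) * v j ^ θ ≤ A ^ (1 - θ) * B ^ θ := by
  have hAp := Real.rpow_pos_of_pos hA (1 - θ)
  have hBp := Real.rpow_pos_of_pos hB θ
  rw [← div_le_one (by positivity), Finset.sum_div]
  calc ∑ j, u j ^ (1 - θ) * v j ^ θ / (A ^ (1 - θ) * B ^ θ)
      ≤ ∑ j, ((1 - θ) * (u j / A) + θ * (v j / B)) := by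
        refine Finset.sum_le_sum fun j _ => ?_
        rw [mul_div_mul_comm, ← Real.div_rpow (hu j) hA.le, ← Real.div_rpow (hv j) hB.le]
        exact Real.geom_mean_le_arith_mean2_weighted (by linarith) hθ.le
          (div_nonneg (hu j) hA.le) (div_nonneg (hv j) hB.le) (by ring)
    _ = (1 - θ) * ((∑ j, u j) / A) + θ * ((∑ j, v j) / B) := by
        rw [Finset.sum_add_distrib, ← Finset.mul_sum, ← Finset.mul_sum, Finset.sum_div,
          Finset.sum_div]
    _ ≤ (1 - θ) * 1 + θ * 1 := by
        gcongr
        · exact (div_le_one hA).2 huA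
        · exact (div_le_one hB).2 hvB
    _ = 1 := by ring

/-- Interpolated multipliers for the elements of the Calderón product of 2-concave lattices. -/
lemma exists_multLog_of_mem_calLog {n : ℕ} {θ : ℝ} (hθ : 0 < θ) (hθ1 : θ < 1)
    {N₀ N₁ : (Fin n → ℝ) → ℝ} (h₀ : IsLatticeNorm N₀) (h₁ : IsLatticeNorm N₁) {M₀ M₁ : ℝ}
    (hM₀ : 0 < M₀) (hM₁ : 0 < M₁) (hc₀ : ConcaveWith 2 M₀ N₀) (hc₁ : ConcaveWith 2 M₁ N₁)
    {κ : ℝ} (hκ : 0 < κ) {γ : Fin n → ℝ} (hγ : γ ∈ calLog θ κ N₀ N₁) :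
    ∃ s₀ ∈ multLog N₀, ∃ s₁ ∈ multLog N₁,
      ∑ j, Real.exp (γ j) ^ 2 * Real.exp (-((1 - θ) * s₀ j + θ * s₁ j)) ≤
        (κ * (M₀ ^ (1 - θ) * M₁ ^ θ)) ^ 2 := by
  obtain ⟨G, H, hG, hH, rfl⟩ := hγ
  obtain ⟨s₀, hs₀, hsum₀⟩ := exists_multiplier h₀ hM₀ hc₀ (fun j => Real.exp_pos (G j)) hκ hG.le
  obtain ⟨s₁, hs₁, hsum₁⟩ := exists_multiplier h₁ hM₁ hc₁ (fun j => Real.exp_pos (H j)) hκ hH.le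
  refine ⟨s₀, hs₀, s₁, hs₁, ?_⟩
  have hle := sum_rpow_mul_rpow_le hθ hθ1 (fun j => by positivity) (fun j => by positivity)
    (by positivity) (by positivity) hsum₀ hsum₁
  calc _ = ∑ j, (Real.exp (G j) ^ 2 * Real.exp (-s₀ j)) ^ (1 - θ) *
        (Real.exp (H j) ^ 2 * Real.exp (-s₁ j)) ^ θ := by
        refine Finset.sum_congr rfl fun j _ => ?_
        simp only [Pi.add_apply, Pi.smul_apply, smul_eq_mul, ← Real.exp_nat_mul, ← Real.exp_add,
          ← Real.exp_mul]
        congr 1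
        push_cast
        ring
    _ ≤ _ := hle
    _ = (κ * (M₀ ^ (1 - θ) * M₁ ^ θ)) ^ 2 := by
        rw [← Real.rpow_natCast (M₀ * κ), ← Real.rpow_natCast (M₁ * κ),
          ← Real.rpow_mul (by positivity), ← Real.rpow_mul (by positivity), mul_comm _ (1 - θ),
          mul_comm _ θ, Real.rpow_mul (by positivity), Real.rpow_mul (by positivity),
          Real.rpow_natCast, Real.rpow_natCast, ← mul_pow, Real.mul_rpow hM₀.le hκ.le,
          Real.mul_rpow hM₁.le hκ.le]
        congr 1
        have h : κ ^ (1 - θ) * κ ^ θ = κ := by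
          rw [← Real.rpow_add hκ, sub_add_cancel, Real.rpow_one]
        linear_combination M₀ ^ (1 - θ) * M₁ ^ θ * h

/-- Coordinatewise squared norms of the image of the unit ball of `ℓ₂`. -/
def sqImage {n k : ℕ} (NE : (Fin k → ℂ) → ℝ) (T : Hilb →L[ℂ] (Fin n → Fin k → ℂ)) :
    Set (Fin n → ℝ) :=
  {q | ∃ x : Hilb, ‖x‖ ≤ 1 ∧ q = fun j => NE (T x j) ^ 2}

lemma isBounded_sqImage {n k : ℕ} {NE : (Fin k → ℂ) → ℝ} (hE : IsNormC NE)
    (T : Hilb →L[ℂ] (Fin n → Fin k → ℂ)) : Bornology.IsBounded (sqImage NE T) := by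
  obtain ⟨A, hA, h⟩ := hE.exists_le_mul_norm
  refine (Metric.isBounded_Icc (0 : Fin n → ℝ) fun _ => (A * ‖T‖) ^ 2).subset ?_
  rintro _ ⟨x, hx, rfl⟩
  refine ⟨fun j => sq_nonneg _, fun j => pow_le_pow_left₀ (hE.1 _) ((h _).trans ?_) 2⟩
  refine mul_le_mul_of_nonneg_left ((norm_le_pi_norm _ j).trans ?_) hA
  simpa using T.le_opNorm_of_le (c := 1) hx

lemma IsNormC.sq_map_smul {k : ℕ} {NE : (Fin k → ℂ) → ℝ} (hE : IsNormC NE) (r : ℝ)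
    (v : Fin k → ℂ) : NE ((r : ℂ) • v) ^ 2 = r ^ 2 * NE v ^ 2 := by
  rw [hE.2.2.1, Complex.norm_real, mul_pow, Real.norm_eq_abs, sq_abs]

lemma exists_of_mem_convexHull_sqImage {n k : ℕ} {NE : (Fin k → ℂ) → ℝ} (hE : IsNormC NE)
    {T : Hilb →L[ℂ] (Fin n → Fin k → ℂ)} {a : Fin n → ℝ} (ha : a ∈ convexHull ℝ (sqImage NE T)) :
    ∃ (m : ℕ) (x : Fin m → Hilb), ∑ i, ‖x i‖ ^ 2 ≤ 1 ∧ ∀ j, a j = ∑ i, NE (T (x i) j) ^ 2 := by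
  obtain ⟨ι, _, w, z, hw, hw1, hz, rfl⟩ := mem_convexHull_iff_exists_fintype.1 ha
  choose x hx hzx using hz
  let e := (Fintype.equivFin ι).symm
  refine ⟨Fintype.card ι, fun i => ((Real.sqrt (w (e i)) : ℝ) : ℂ) • x (e i), ?_, fun j => ?_⟩
  · calc ∑ i, ‖((Real.sqrt (w (e i)) : ℝ) : ℂ) • x (e i)‖ ^ 2 ≤ ∑ i, w (e i) := by
          refine Finset.sum_le_sum fun i _ => ?_
          rw [norm_smul, Complex.norm_real, mul_pow, Real.norm_eq_abs, sq_abs,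
            Real.sq_sqrt (hw _)]
          exact mul_le_of_le_one_right (hw _) (pow_le_one₀ (norm_nonneg _) (hx _))
      _ = 1 := by rw [e.sum_comp w, hw1]
  · rw [Finset.sum_apply, ← e.sum_comp]
    refine Finset.sum_congr rfl fun i _ => ?_
    rw [map_smul, Pi.smul_apply, Pi.smul_apply, hE.sq_map_smul, Real.sq_sqrt (hw _), hzx,
      smul_eq_mul]

lemma exists_multLog_sum_lt {n k : ℕ} {θ : ℝ} (hθ : 0 < θ) (hθ1 : θ < 1)
    {N₀ N₁ : (Fin n → ℝ) → ℝ} (h₀ : IsLatticeNorm N₀) (h₁ : IsLatticeNorm N₁) {M₀ M₁ : ℝ}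
    (hM₀ : 0 < M₀) (hM₁ : 0 < M₁) (hc₀ : ConcaveWith 2 M₀ N₀) (hc₁ : ConcaveWith 2 M₁ N₁)
    {NE : (Fin k → ℂ) → ℝ} (hE : IsNormC NE) {C : ℝ} (hC : 0 < C) (hcot : Cotype2With NE C)
    {T : Hilb →L[ℂ] (Fin n → Fin k → ℂ)}
    (hT : ∀ (x : Hilb) (ρ : ℝ), ‖x‖ < ρ →
      AnalyticBound θ (vecLatNorm N₀ NE) (vecLatNorm N₁ NE) (T x) ρ)
    {K : ℝ} (hK : Real.sqrt 2 * C * (M₀ ^ (1 - θ) * M₁ ^ θ) < K)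
    {a : Fin n → ℝ} (ha : a ∈ closure (convexHull ℝ (sqImage NE T))) :
    ∃ s₀ ∈ multLog N₀, ∃ s₁ ∈ multLog N₁,
      ∑ j, Real.exp (-((1 - θ) * s₀ j + θ * s₁ j)) * a j < K ^ 2 := by
  set R := Real.sqrt 2 * C with hR
  set M := M₀ ^ (1 - θ) * M₁ ^ θ with hM
  have hRpos : 0 < R := by positivity
  have hMpos : 0 < M := by positivity
  obtain ⟨κ, hκ1, hκK⟩ := exists_between ((one_lt_div (mul_pos hRpos hMpos)).2 hK)
  rw [lt_div_iff₀ (mul_pos hRpos hMpos)] at hκK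
  have hA : 0 < 1 + (N₀ 1 + N₁ 1) := by linarith [h₀.1 1, h₁.1 1]
  set η := (κ - 1) / 2 / (1 + (N₀ 1 + N₁ 1)) with hη
  have hηpos : 0 < η := div_pos (by linarith) hA
  have hηκ : 1 + η + η * (N₀ 1 + N₁ 1) < κ := by
    have : η * (1 + (N₀ 1 + N₁ 1)) = (κ - 1) / 2 := div_mul_cancel₀ _ hA.ne'
    linarith
  obtain ⟨a', ha', hdist⟩ := Metric.mem_closure_iff.1 ha ((R * η) ^ 2) (by positivity)
  obtain ⟨m, x, hx, hax⟩ := exists_of_mem_convexHull_sqImage hE ha'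
  obtain ⟨s₀, hs₀, s₁, hs₁, hs⟩ := exists_multLog_of_mem_calLog hθ hθ1 h₀ h₁ hM₀ hM₁ hc₀ hc₁
    (by linarith) (log_mean_mem_calLog hθ hθ1 h₀ h₁ hE hT hx hηpos hηκ)
  refine ⟨s₀, hs₀, s₁, hs₁, ?_⟩
  set b : Fin n → ℝ := fun j => ((2 : ℝ) ^ m)⁻¹ *
    ∑ ε : Fin m → Bool, NE (∑ i, if ε i then T (x i) j else -T (x i) j) with hb
  have hb0 : ∀ j, 0 ≤ b j := fun j =>
    mul_nonneg (by positivity) (Finset.sum_nonneg fun ε _ => hE.1 _)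
  have hexp : ∀ j, Real.exp (Real.log (b j + η)) = b j + η := fun j =>
    Real.exp_log (by linarith [hb0 j])
  have hle : ∀ j, a j ≤ R ^ 2 * (b j + η) ^ 2 := by
    intro j
    have hdj : a j - a' j ≤ (R * η) ^ 2 :=
      (le_abs_self _).trans ((dist_le_pi_dist a a' j).trans hdist.le)
    have hcj : Real.sqrt (a' j) ≤ R * b j := by
      rw [hax]
      exact hcot.sqrt_sum_sq_le hE hC.le fun i => T (x i) j
    have ha0 : 0 ≤ a' j := by
      rw [hax]
      positivity
    have hsq := Real.sq_sqrt ha0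
    have hRη : 0 < R * η := mul_pos hRpos hηpos
    nlinarith [Real.sqrt_nonneg (a' j), mul_nonneg hRpos.le (hb0 j),
      pow_le_pow_left₀ (Real.sqrt_nonneg (a' j)) hcj 2]
  calc ∑ j, Real.exp (-((1 - θ) * s₀ j + θ * s₁ j)) * a j
      ≤ ∑ j, R ^ 2 * (Real.exp (Real.log (b j + η)) ^ 2 *
          Real.exp (-((1 - θ) * s₀ j + θ * s₁ j))) := by
        refine Finset.sum_le_sum fun j _ => ?_
        rw [hexp, ← mul_assoc, mul_comm]
        exact mul_le_mul_of_nonneg_right (hle j) (Real.exp_nonneg _)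
    _ ≤ R ^ 2 * (κ * M) ^ 2 := by
        rw [← Finset.mul_sum]
        exact mul_le_mul_of_nonneg_left hs (sq_nonneg _)
    _ = (κ * (R * M)) ^ 2 := by ring
    _ < K ^ 2 := pow_lt_pow_left₀ hκK (by positivity) two_ne_zero

/-- The multipliers of `exists_multLog_sum_lt` can be chosen uniformly, by minimax. -/
lemma exists_multLog_forall_le {n k : ℕ} {θ : ℝ} (hθ : 0 < θ) (hθ1 : θ < 1)
    {N₀ N₁ : (Fin n → ℝ) → ℝ} (h₀ : IsLatticeNorm N₀) (h₁ : IsLatticeNorm N₁) {M₀ M₁ : ℝ}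
    (hM₀ : 0 < M₀) (hM₁ : 0 < M₁) (hc₀ : ConcaveWith 2 M₀ N₀) (hc₁ : ConcaveWith 2 M₁ N₁)
    {NE : (Fin k → ℂ) → ℝ} (hE : IsNormC NE) {C : ℝ} (hC : 0 < C) (hcot : Cotype2With NE C)
    {T : Hilb →L[ℂ] (Fin n → Fin k → ℂ)}
    (hT : ∀ (x : Hilb) (ρ : ℝ), ‖x‖ < ρ →
      AnalyticBound θ (vecLatNorm N₀ NE) (vecLatNorm N₁ NE) (T x) ρ)
    {K : ℝ} (hK : Real.sqrt 2 * C * (M₀ ^ (1 - θ) * M₁ ^ θ) < K) :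
    ∃ s₀ ∈ multLog N₀, ∃ s₁ ∈ multLog N₁, ∀ x,
      ∑ j, NE (T x j) ^ 2 * Real.exp (-((1 - θ) * s₀ j + θ * s₁ j)) ≤ K ^ 2 * ‖x‖ ^ 2 := by
  by_contra! hcon
  set D : Set (Fin n → ℝ) := {p | ∃ s₀ ∈ multLog N₀, ∃ s₁ ∈ multLog N₁,
    ∀ j, Real.exp (-((1 - θ) * s₀ j + θ * s₁ j)) ≤ p j} with hD
  have hDconv : Convex ℝ D := by
    rintro p ⟨s₀, hs₀, s₁, hs₁, hp⟩ q ⟨t₀, ht₀, t₁, ht₁, hq⟩ c d hc hd hcd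
    refine ⟨_, convex_multLog h₀ hs₀ ht₀ hc hd hcd, _, convex_multLog h₁ hs₁ ht₁ hc hd hcd,
      fun j => ?_⟩
    have hconv := convexOn_exp.2 (Set.mem_univ (-((1 - θ) * s₀ j + θ * s₁ j)))
      (Set.mem_univ (-((1 - θ) * t₀ j + θ * t₁ j))) hc hd hcd
    simp only [smul_eq_mul, Pi.add_apply, Pi.smul_apply] at hconv ⊢
    calc _ = Real.exp (c * -((1 - θ) * s₀ j + θ * s₁ j) + d * -((1 - θ) * t₀ j + θ * t₁ j)) := by
          congr 1
          ring
      _ ≤ _ := hconv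
      _ ≤ _ := add_le_add (mul_le_mul_of_nonneg_left (hp j) hc)
          (mul_le_mul_of_nonneg_left (hq j) hd)
  have hne : (sqImage NE T).Nonempty := ⟨_, 0, by simp, rfl⟩
  have hLD : ∀ q ∈ D, ∃ l ∈ closure (convexHull ℝ (sqImage NE T)), K ^ 2 ≤ ∑ j, q j * l j := by
    rintro p ⟨s₀, hs₀, s₁, hs₁, hp⟩
    obtain ⟨x, hx⟩ := hcon s₀ hs₀ s₁ hs₁
    have hx0 : 0 < ‖x‖ := by
      rw [norm_pos_iff]
      rintro rfl
      have hz : NE 0 = 0 := by simpa using hE.2.2.1 0 0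
      simp [hz] at hx
    refine ⟨_, subset_closure (subset_convexHull ℝ _ ⟨((‖x‖⁻¹ : ℝ) : ℂ) • x, ?_, rfl⟩), ?_⟩
    · rw [norm_smul, Complex.norm_real, norm_inv, norm_norm, inv_mul_cancel₀ hx0.ne']
    · have hx2 : 0 < ‖x‖ ^ 2 := by positivity
      calc K ^ 2 ≤ (‖x‖ ^ 2)⁻¹ *
            ∑ j, NE (T x j) ^ 2 * Real.exp (-((1 - θ) * s₀ j + θ * s₁ j)) := by
            rw [le_inv_mul_iff₀ hx2, mul_comm]
            exact hx.le
        _ ≤ _ := by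
            rw [Finset.mul_sum]
            refine Finset.sum_le_sum fun j _ => ?_
            rw [map_smul, Pi.smul_apply, hE.sq_map_smul, inv_pow, ← mul_assoc, mul_comm]
            exact mul_le_mul_of_nonneg_right (hp j) (by positivity)
  obtain ⟨a, ha, hDa⟩ := exists_forall_le_sum_mul
    (isBounded_convexHull.2 (isBounded_sqImage hE T)).isCompact_closure
    (convex_convexHull ℝ _).closure hne.convexHull.closure hDconv (K ^ 2) hLD
  obtain ⟨s₀, hs₀, s₁, hs₁, hs⟩ :=
    exists_multLog_sum_lt hθ hθ1 h₀ h₁ hM₀ hM₁ hc₀ hc₁ hE hC hcot hT hK ha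
  exact absurd (hDa _ ⟨s₀, hs₀, s₁, hs₁, fun j => le_rfl⟩) (not_le.2 hs)

lemma dTheta_le_of_pos {n k : ℕ} {θ : ℝ} (hθ : 0 < θ) (hθ1 : θ < 1)
    {N₀ N₁ : (Fin n → ℝ) → ℝ} (h₀ : IsLatticeNorm N₀) (h₁ : IsLatticeNorm N₁) {M₀ M₁ : ℝ}
    (hM₀ : 0 < M₀) (hM₁ : 0 < M₁) (hc₀ : ConcaveWith 2 M₀ N₀) (hc₁ : ConcaveWith 2 M₁ N₁)
    {NE : (Fin k → ℂ) → ℝ} (hE : IsNormC NE) {C : ℝ} (hC : 0 < C) (hcot : Cotype2With NE C) :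
    dTheta θ (vecLatNorm N₀ NE) (vecLatNorm N₁ NE) ≤
      Real.sqrt 2 * C * (M₀ ^ (1 - θ) * M₁ ^ θ) := by
  refine Real.sSup_le ?_ (by positivity)
  rintro _ ⟨T, hT, rfl⟩
  refine le_of_forall_gt_imp_ge_of_dense fun K hK => ?_
  obtain ⟨s₀, hs₀, s₁, hs₁, hs⟩ := exists_multLog_forall_le hθ hθ1 h₀ h₁ hM₀ hM₁ hc₀ hc₁ hE hC
    hcot (fun x ρ hx => analyticBound_of_opN_le_one h₀ h₁ hE T hT hx) hK
  exact interpN_opN_le h₀ hE T hs₀ hs₁ (le_trans (by positivity) hK.le) hs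

lemma ConcaveWith.mono {n : ℕ} {p M M' : ℝ} {N : (Fin n → ℝ) → ℝ} (hN : IsLatticeNorm N)
    (h : ConcaveWith p M N) (hM : M ≤ M') : ConcaveWith p M' N := fun m x =>
  (h m x).trans (mul_le_mul_of_nonneg_right hM (hN.1 _))

lemma Cotype2With.mono {V : Type*} [AddCommGroup V] {N : V → ℝ} {C C' : ℝ}
    (h : Cotype2With N C) (hC : C ≤ C') : Cotype2With N C' := fun m x =>
  (h m x).trans (mul_le_mul_of_nonneg_right hC (Real.sqrt_nonneg _))

/-- Corollary 6:
`d_θ[X₀(E),X₁(E)] ≤ √2·C₂(E)·M_(2)(X₀)^{1-θ}·M_(2)(X₁)^θ`. -/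
theorem statement16 {n k : ℕ} (θ : ℝ) (hθ : 0 < θ) (hθ1 : θ < 1)
    (NX₀ NX₁ : (Fin n → ℝ) → ℝ)
    (hX₀ : IsLatticeNorm NX₀) (hX₁ : IsLatticeNorm NX₁)
    (M₀ M₁ : ℝ) (hM₀ : 0 ≤ M₀) (hM₁ : 0 ≤ M₁)
    (hc₀ : ConcaveWith 2 M₀ NX₀) (hc₁ : ConcaveWith 2 M₁ NX₁)
    (NE : (Fin k → ℂ) → ℝ) (hE : IsNormC NE)
    (C : ℝ) (hC : 0 ≤ C) (hcot : Cotype2With NE C) :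
    dTheta θ (vecLatNorm NX₀ NE) (vecLatNorm NX₁ NE) ≤
      Real.sqrt 2 * C * M₀ ^ (1 - θ) * M₁ ^ θ := by
  have hcont : ContinuousWithinAt
      (fun ε : ℝ => Real.sqrt 2 * (C + ε) * ((M₀ + ε) ^ (1 - θ) * (M₁ + ε) ^ θ)) (Set.Ioi 0) 0 := by
    refine Continuous.continuousWithinAt ?_
    have e₀ : Continuous fun ε : ℝ => (M₀ + ε) ^ (1 - θ) :=
      (continuous_const.add continuous_id).rpow_const fun _ => Or.inr (by linarith)
    have e₁ : Continuous fun ε : ℝ => (M₁ + ε) ^ θ :=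
      (continuous_const.add continuous_id).rpow_const fun _ => Or.inr hθ.le
    fun_prop
  refine (ge_of_tendsto hcont (Filter.eventually_of_mem self_mem_nhdsWithin
    fun ε (hε : 0 < ε) => ?_)).trans_eq (by simp only [add_zero]; ring)
  exact dTheta_le_of_pos hθ hθ1 hX₀ hX₁ (by positivity) (by positivity)
    (hc₀.mono hX₀ (by linarith)) (hc₁.mono hX₁ (by linarith)) hE (by positivity)
    (hcot.mono (by linarith))

end Paper
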